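/- arXiv:1703.02943 — 2 statements merged into one kernel-verified Lean document; each statement's English description precedes it below -/
import Mathlib

section
/- The maximum number of equiangular lines in ℝ¹² with common angle 1/5 is exactly 20: there exist unit vectors x₁, …, x₂₀ in ℝ¹² with |⟨x_i, x_j⟩| = 1/5 for all i ≠ j, but there do not exist unit vectors x₁, …, x₂₁ in ℝ¹² with |⟨x_i, x_j⟩| = 1/5 for all i ≠ j. -/
open scoped RealInnerProductSpace

/-- Twenty integer vectors which, for the weights `lineWeight`, span equiangular lines. -/
def lineCoord : Fin 20 → Fin 12 → ℤ :=
  ![![1, -2, 2, -2, 1, 0, -1, 1, 1, -1, 3, 0],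
    ![-1, -3, 9, 0, 0, 0, 0, 0, 0, 0, 0, 0],
    ![-1, -3, -3, 3, 0, -3, 0, 0, 0, 0, 0, 0],
    ![1, -2, 2, -2, -2, 0, 2, -2, -2, 2, 0, 0],
    ![1, -2, 2, 1, -2, 1, -4, 4, 0, 0, 0, 0],
    ![-1, -3, 1, -1, -1, 1, -2, 0, -2, 0, 1, 1],
    ![-1, -3, 1, -1, 2, 1, 4, 0, 4, 0, 0, 0],
    ![5, 0, 0, 0, 0, 0, 0, 0, 0, 0, 0, 0],
    ![-1, 2, -2, -1, 2, 1, -2, 2, -2, 2, 0, 0],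
    ![1, -2, -2, 2, 2, 0, -2, -2, 2, 2, 0, 0],
    ![-1, -3, -3, 3, 0, 3, 0, 0, 0, 0, 0, 0],
    ![1, 3, -1, 1, 1, -1, 2, 0, 2, 0, 1, 1],
    ![1, 3, 3, 0, 6, 0, 0, 0, 0, 0, 0, 0],
    ![-1, 2, -2, 2, -1, 0, 1, -1, -1, 1, 3, 0],
    ![1, 3, -1, 1, -2, 1, 8, 0, 0, 0, 0, 0],
    ![-1, 2, 2, 1, -2, 1, -4, -4, 0, 0, 0, 0],
    ![-1, 12, 0, 0, 0, 0, 0, 0, 0, 0, 0, 0],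
    ![1, 3, 3, 6, 0, 0, 0, 0, 0, 0, 0, 0],
    ![-1, 2, 2, 1, -2, -1, 2, 2, 2, 2, 0, 0],
    ![1, 3, -1, -2, -2, 0, -4, 0, 4, 0, 0, 0]]

/-- The weights of the coordinates for `lineCoord`, up to the common factor `450`. -/
def lineWeight : Fin 12 → ℤ := ![18, 3, 5, 10, 10, 30, 5, 15, 15, 45, 30, 240]

lemma sum_lineCoord_self (i : Fin 20) :
    ∑ k, lineCoord i k * lineCoord i k * lineWeight k = 450 := by
  revert i; decide +kernel

lemma abs_sum_lineCoord (i j : Fin 20) (h : i ≠ j) :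
    |∑ k, lineCoord i k * lineCoord j k * lineWeight k| = 90 := by
  revert i j; decide +kernel

lemma lineWeight_nonneg (k : Fin 12) : 0 ≤ lineWeight k := by
  revert k; decide

theorem exists_twenty_equiangular :
    ∃ x : Fin 20 → EuclideanSpace ℝ (Fin 12),
      (∀ i, ‖x i‖ = 1) ∧ ∀ i j, i ≠ j → |⟪x i, x j⟫| = 1 / 5 := by
  let x : Fin 20 → EuclideanSpace ℝ (Fin 12) := fun i =>
    WithLp.toLp 2 fun k => (lineCoord i k : ℝ) * √((lineWeight k : ℝ) / 450)
  have key : ∀ i j, ⟪x i, x j⟫ =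
      ((∑ k, lineCoord i k * lineCoord j k * lineWeight k : ℤ) : ℝ) / 450 := by
    intro i j
    rw [PiLp.inner_apply]
    push_cast
    rw [Finset.sum_div]
    refine Finset.sum_congr rfl fun k _ => ?_
    have hw : (0 : ℝ) ≤ (lineWeight k : ℝ) / 450 :=
      div_nonneg (by exact_mod_cast lineWeight_nonneg k) (by norm_num)
    have hs := Real.mul_self_sqrt hw
    simp only [x, RCLike.inner_apply, conj_trivial]
    linear_combination (lineCoord i k : ℝ) * lineCoord j k * hs
  refine ⟨x, fun i => ?_, fun i j hij => ?_⟩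
  · have h : ‖x i‖ ^ 2 = 1 := by
      rw [← real_inner_self_eq_norm_sq, key, sum_lineCoord_self]; norm_num
    exact (pow_eq_one_iff_of_nonneg (norm_nonneg _) two_ne_zero).1 h
  · rw [key, abs_div, ← Int.cast_abs, abs_sum_lineCoord i j hij]; norm_num

open Polynomial in
/-- `ev` and the columns of `U` are the eigenvalues and an orthonormal eigenbasis of the symmetric
integer matrix `N`. -/
structure IsSpectralFrame {n : Type*} [Fintype n] [DecidableEq n] (N : Matrix n n ℤ) (ev : n → ℝ)
    (U : n → n → ℝ) : Prop where
  entry : ∀ (p : ℤ[X]) (i j : n),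
    ((aeval N p i j : ℤ) : ℝ) = ∑ k, aeval (ev k) p * (U i k * U j k)
  orthonormal : ∀ k l, ∑ i, U i k * U i l = if k = l then 1 else 0
  charpoly : N.charpoly.map (Int.castRingHom ℝ) = ∏ k, (X - C (ev k))

namespace IsSpectralFrame

open Polynomial Matrix

section General

variable {n : Type*} [Fintype n] [DecidableEq n]

theorem exists_of_isSymm (N : Matrix n n ℤ) (hN : N.IsSymm) :
    ∃ ev U, IsSpectralFrame N ev U := by
  have hA : (N.map (Int.castRingHom ℝ)).IsHermitian := by
    ext i j
    simp [hN.apply i j]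
  refine ⟨hA.eigenvalues, fun i k => (hA.eigenvectorUnitary : Matrix n n ℝ) i k, ?_, ?_, ?_⟩
  · intro p i j
    have h1 : (aeval N p).map (Int.castRingHom ℝ) =
        aeval (N.map (Int.castRingHom ℝ)) (p.map (Int.castRingHom ℝ)) := by
      rw [aeval_def, aeval_def, ← RingHom.mapMatrix_apply, ← RingHom.mapMatrix_apply, hom_eval₂,
        eval₂_map]
      congr 1
      exact RingHom.ext_int _ _
    have h2 : aeval (N.map (Int.castRingHom ℝ)) (p.map (Int.castRingHom ℝ)) =
        (hA.eigenvectorUnitary : Matrix n n ℝ) *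
          diagonal (fun k => aeval (hA.eigenvalues k) p) *
          star (hA.eigenvectorUnitary : Matrix n n ℝ) := by
      conv_lhs => rw [hA.spectral_theorem]
      have h := aeval_algHom_apply (((Unitary.conjStarAlgAut ℝ _
        hA.eigenvectorUnitary).toAlgEquiv : Matrix n n ℝ ≃ₐ[ℝ] Matrix n n ℝ) :
          Matrix n n ℝ →ₐ[ℝ] Matrix n n ℝ)
        (diagonalAlgHom ℝ hA.eigenvalues) (p.map (Int.castRingHom ℝ))
      refine h.trans ?_
      rw [aeval_algHom_apply]
      change Unitary.conjStarAlgAut ℝ _ hA.eigenvectorUnitary (diagonal _) = _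
      rw [Unitary.conjStarAlgAut_apply]
      congr 3
      ext k
      rw [aeval_pi_apply₂]
      exact aeval_map_algebraMap ℝ _ _
    have h3 := congrFun (congrFun (h1.trans h2) i) j
    simp only [Matrix.map_apply, Int.coe_castRingHom] at h3
    rw [h3, mul_apply]
    refine Finset.sum_congr rfl fun k _ => ?_
    rw [mul_diagonal, star_apply]
    simp
    ring
  · intro k l
    have h := congrFun (congrFun (Unitary.coe_star_mul_self hA.eigenvectorUnitary) k) l
    rw [mul_apply, one_apply] at h
    rw [← h]
    simp [star_apply]
  · rw [← charpoly_map, hA.charpoly_eq]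
    rfl
end General
end IsSpectralFrame

open Matrix in
/-- An integer matrix `N = J + 2A` of order `21`, symmetric with diagonal `-3` and off-diagonal
entries `±1`, all of whose rows have sum `21 + 4 bᵢ`. -/
structure IsEvenLineMatrix (N A : Matrix (Fin 21) (Fin 21) ℤ) (b : Fin 21 → ℤ) : Prop where
  symm : ∀ i j, A i j = A j i
  eq_add : ∀ i j, N i j = 1 + 2 * A i j
  diag : ∀ i, A i i = -2
  sum_row : ∀ i, ∑ j, A i j = 2 * b i
  off_diag : ∀ i j, i ≠ j → N i j = 1 ∨ N i j = -1

/-- The matrix `N (N - 2) (N + 8)`. -/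
def residualMatrix (N : Matrix (Fin 21) (Fin 21) ℤ) : Matrix (Fin 21) (Fin 21) ℤ :=
  N ^ 3 + (6 : ℤ) • N ^ 2 - (16 : ℤ) • N

theorem even_sum_sum_sub_diag {n : Type*} [Fintype n] [DecidableEq n] (f : n → n → ℤ)
    (hf : ∀ i j, f i j = f j i) : 2 ∣ ∑ i, ∑ j, f i j - ∑ i, f i i := by
  have h : (((∑ i, ∑ j, f i j - ∑ i, f i i : ℤ)) : ZMod 2) = 0 := by
    push_cast
    have h1 : ∑ i, (f i i : ZMod 2) = ∑ i, ∑ j, if i = j then (f i j : ZMod 2) else 0 := by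
      simp
    rw [h1, ← Finset.sum_sub_distrib]
    simp_rw [← Finset.sum_sub_distrib]
    rw [← Fintype.sum_prod_type']
    refine Finset.sum_involution (fun x _ => x.swap) ?_ ?_ ?_ ?_
    · rintro ⟨i, j⟩ -
      by_cases hij : i = j
      · simp [hij]
      · simp [hij, Ne.symm hij, hf j i, CharTwo.add_self_eq_zero]
    · rintro ⟨i, j⟩ - h hs
      simp only [Prod.swap_prod_mk, Prod.mk.injEq] at hs
      simp [hs.1] at h
    · simp
    · simp
  exact (ZMod.intCast_zmod_eq_zero_iff_dvd _ 2).1 h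

namespace IsEvenLineMatrix

open Matrix Finset

variable {N A : Matrix (Fin 21) (Fin 21) ℤ} {b : Fin 21 → ℤ} (h : IsEvenLineMatrix N A b)

/-- The matrix `W` with `N (N - 2) (N + 8) = 8 W + (7 + 4σ) J + 4 (b 1ᵀ + 1 bᵀ)`. -/
def quotientMatrix (A : Matrix (Fin 21) (Fin 21) ℤ) (b : Fin 21 → ℤ) :
    Matrix (Fin 21) (Fin 21) ℤ := fun i j =>
  68 + 13 * (b i + b j) + 2 * (b i * b j) + ((A *ᵥ b) i + (A *ᵥ b) j) + (A * A * A) i j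
    + 3 * (A * A) i j - 4 * A i j

include h

theorem sum_col (j : Fin 21) : ∑ i, A i j = 2 * b j := by
  rw [← h.sum_row]
  exact sum_congr rfl fun i _ => h.symm i j

theorem isSymm : N.IsSymm := by
  ext i j
  simp [h.eq_add, h.symm j i]

theorem sq_apply (i j : Fin 21) :
    (N ^ 2) i j = 21 + 4 * b i + 4 * b j + 4 * (A * A) i j := by
  rw [sq, mul_apply, mul_apply]
  simp_rw [h.eq_add]
  have : ∀ k, (1 + 2 * A i k) * (1 + 2 * A k j) =
      1 + 2 * A i k + 2 * A k j + 4 * (A i k * A k j) := fun k => by ring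
  simp_rw [this, sum_add_distrib, ← mul_sum, h.sum_row, h.sum_col]
  simp
  ring

theorem sum_sq_row (i : Fin 21) : ∑ k, (A * A) i k = 2 * (A *ᵥ b) i := by
  simp_rw [mul_apply]
  rw [sum_comm]
  simp_rw [← mul_sum, h.sum_row, mulVec, dotProduct, mul_sum]
  exact sum_congr rfl fun k _ => by ring

theorem cube_apply (i j : Fin 21) :
    (N ^ 3) i j = 441 + 84 * (b i + b j) + 4 * ∑ k, b k + 8 * ((A *ᵥ b) i + (A *ᵥ b) j)
      + 16 * (b i * b j) + 8 * (A * A * A) i j := by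
  rw [pow_succ, mul_apply]
  simp_rw [h.sq_apply, h.eq_add]
  have : ∀ k, (21 + 4 * b i + 4 * b k + 4 * (A * A) i k) * (1 + 2 * A k j) =
      21 + 4 * b i + 4 * b k + 4 * (A * A) i k + (42 + 8 * b i) * A k j + 8 * (A j k * b k)
       + 8 * ((A * A) i k * A k j) := fun k => by rw [h.symm j k]; ring
  simp_rw [this, sum_add_distrib, ← mul_sum, h.sum_col, h.sum_sq_row]
  rw [mul_apply (M := A * A)]
  simp [mulVec, dotProduct]
  ring

theorem residual_apply (i j : Fin 21) :
    residualMatrix N i j = 8 * quotientMatrix A b i j + (7 + 4 * ∑ k, b k) + 4 * (b i + b j) := by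
  simp only [residualMatrix, Matrix.sub_apply, Matrix.add_apply, Matrix.smul_apply, h.cube_apply,
    h.sq_apply,
    quotientMatrix, h.eq_add, smul_eq_mul]
  ring

theorem even_quotient_diag (i : Fin 21) : 2 ∣ quotientMatrix A b i i := by
  have h3 : 2 ∣ (A * A * A) i i := by
    have e : (A * A * A) i i = ∑ k, ∑ l, A i k * A k l * A l i := by
      simp_rw [mul_apply, sum_mul]
      rw [sum_comm]
    have := even_sum_sum_sub_diag (fun k l => A i k * A k l * A l i) fun k l => by
      rw [h.symm i k, h.symm k l, h.symm l i]; ring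
    rw [e]
    have d : 2 ∣ ∑ k, A i k * A k k * A k i :=
      dvd_sum fun k _ => by rw [h.diag]; exact ⟨-(A i k * A k i), by ring⟩
    exact (dvd_sub_left d).1 this
  have h2 : 2 ∣ (A * A) i i := by
    have e : (A * A) i i = ∑ k, (A i k * (A i k - 1)) + 2 * b i := by
      rw [mul_apply, ← h.sum_row, ← sum_add_distrib]
      exact sum_congr rfl fun k _ => by rw [h.symm k i]; ring
    rw [e]
    exact dvd_add (dvd_sum fun k _ => (Int.even_mul_pred_self _).two_dvd) ⟨_, rfl⟩
  simp only [quotientMatrix, h.diag]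
  omega

theorem sum_quotient_col (i : Fin 21) :
    2 ∣ ∑ k, quotientMatrix A b k i - (∑ k, b k + b i + (A *ᵥ b) i) := by
  have h1 : ∑ k, (A *ᵥ b) k = 2 * ∑ k, b k * b k := by
    simp_rw [mulVec, dotProduct]
    rw [sum_comm]
    simp_rw [← sum_mul, h.sum_col, mul_sum]
    exact sum_congr rfl fun k _ => by ring
  have h2 : ∑ k, (A * A) k i = 2 * ∑ k, b k * A k i := by
    simp_rw [mul_apply]
    rw [sum_comm]
    simp_rw [← sum_mul, h.sum_col, mul_sum]
    exact sum_congr rfl fun k _ => by ring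
  have h3 : ∑ k, (A * A * A) k i = 2 * ∑ k, b k * (A * A) k i := by
    simp_rw [mul_assoc A A A, mul_apply (M := A) (N := A * A)]
    rw [sum_comm]
    simp_rw [← sum_mul, h.sum_col, mul_sum]
    exact sum_congr rfl fun k _ => by ring
  simp_rw [quotientMatrix, sum_sub_distrib, sum_add_distrib, ← mul_sum, sum_add_distrib,
    ← sum_mul, h1, h2, h3, h.sum_col]
  simp
  omega

theorem residual_mul_apply (i j : Fin 21) :
    (N * residualMatrix N) i j = 8 * (N * quotientMatrix A b) i j
      + (7 + 4 * ∑ k, b k + 4 * b j) * (21 + 4 * b i) + 4 * ∑ k, b k + 8 * (A *ᵥ b) i := by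
  rw [mul_apply, mul_apply]
  simp_rw [h.residual_apply]
  have : ∀ k, N i k * (8 * quotientMatrix A b k j + (7 + 4 * ∑ k, b k) + 4 * (b k + b j)) =
      8 * (N i k * quotientMatrix A b k j) + (7 + 4 * ∑ k, b k + 4 * b j) * (1 + 2 * A i k)
        + 4 * b k + 8 * (A i k * b k) := fun k => by rw [h.eq_add i k]; ring
  simp_rw [this, sum_add_distrib, ← mul_sum, sum_add_distrib, ← mul_sum, h.sum_row]
  simp only [mulVec, dotProduct, sum_const, card_univ, Fintype.card_fin, nsmul_eq_mul]
  push_cast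
  ring

theorem residual_isSymm : (residualMatrix N).IsSymm := by
  have := h.isSymm
  simp only [residualMatrix, IsSymm, transpose_sub, transpose_add, transpose_smul,
    transpose_pow, this.eq]

omit h in
theorem residual_commute : N * residualMatrix N = residualMatrix N * N := by
  simp only [residualMatrix, mul_sub, mul_add, sub_mul, add_mul, Matrix.mul_smul, Matrix.smul_mul,
    ← pow_succ, ← pow_succ', ← sq]

theorem mul_parity (M : Matrix (Fin 21) (Fin 21) ℤ) (i j : Fin 21) :
    2 ∣ (N * M) i j - ∑ k, M k j := by
  rw [mul_apply, ← sum_sub_distrib]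
  exact dvd_sum fun k _ => ⟨A i k * M k j, by rw [h.eq_add]; ring⟩

theorem mul_parity_const {M : Matrix (Fin 21) (Fin 21) ℤ} (hM : (N * M).IsSymm) (i j : Fin 21) :
    2 ∣ (N * M) i i - (N * M) j j := by
  have h1 := h.mul_parity M i i
  have h2 := h.mul_parity M j i
  have h3 := h.mul_parity M i j
  have h4 := h.mul_parity M j j
  have h5 := hM.apply i j
  omega

omit h in
theorem dvd_sub_sum {f : Fin 21 → ℤ} (hf : ∀ i j, 2 ∣ f i - f j) (i : Fin 21) :
    2 ∣ f i - ∑ j, f j := by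
  have h1 : 2 ∣ ∑ j, (f i - f j) := dvd_sum fun j _ => hf i j
  rw [sum_sub_distrib] at h1
  simp only [sum_const, card_univ, Fintype.card_fin, nsmul_eq_mul] at h1
  push_cast at h1
  omega

theorem exists_even_quotient {s : ℤ} (hs : ∑ k, b k = 2 * s) :
    ∃ V : Matrix (Fin 21) (Fin 21) ℤ,
      ∀ i j, (N * residualMatrix N) i j = 5 * residualMatrix N i j + 8 * V i j := by
  refine ⟨fun i j => (N * quotientMatrix A b) i j - 5 * quotientMatrix A b i j + (14 + 17 * s)
    + (1 + 4 * s) * b i + 8 * b j + 2 * (b i * b j) + (A *ᵥ b) i, fun i j => ?_⟩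
  rw [h.residual_mul_apply, h.residual_apply, hs]
  ring

theorem exists_odd_quotient {s : ℤ} (hs : ∑ k, b k = 2 * s + 1) :
    ∃ V : Matrix (Fin 21) (Fin 21) ℤ, (∀ i j, 2 ∣ V i i - V j j) ∧
      ∀ i j, (N * residualMatrix N) i j = residualMatrix N i j + 8 * V i j := by
  refine ⟨fun i j => (N * quotientMatrix A b) i j - quotientMatrix A b i j + (28 + 21 * s)
    + (5 + 4 * s) * b i + 10 * b j + 2 * (b i * b j) + (A *ᵥ b) i, fun i j => ?_, fun i j => ?_⟩
  · have key : ∀ i, 2 ∣ (N * quotientMatrix A b) i i - quotientMatrix A b i i + (28 + 21 * s)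
        + (5 + 4 * s) * b i + 10 * b i + 2 * (b i * b i) + (A *ᵥ b) i - (1 + s) := fun i => by
      have h1 := h.mul_parity (quotientMatrix A b) i i
      have h2 := h.even_quotient_diag i
      have h3 := h.sum_quotient_col i
      have h4 : (5 + 4 * s) * b i = 5 * b i + 2 * (2 * s * b i) := by ring
      rw [h4]
      omega
    have h1 := key i
    have h2 := key j
    have h3 := dvd_sub h1 h2
    rwa [sub_sub_sub_cancel_right] at h3
  · rw [h.residual_mul_apply, h.residual_apply, hs]
    ring

theorem trace_residual : 16 ∣ (residualMatrix N).trace - (147 + 92 * ∑ k, b k) := by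
  simp_rw [trace, diag_apply, h.residual_apply, sum_add_distrib, ← mul_sum, sum_add_distrib]
  have : 2 ∣ ∑ i, quotientMatrix A b i i := dvd_sum fun i _ => h.even_quotient_diag i
  simp
  omega

/-- Diagonal entries of `N (N - 2) (N + 8) Nⁿ`. -/
theorem congr_of_trace_mod_eq_three (ht : (residualMatrix N).trace % 8 = 3) (i : Fin 21) :
    8 ∣ residualMatrix N i i - 7 ∧ 8 ∣ (N * residualMatrix N) i i - 5 * residualMatrix N i i ∧
    16 ∣ (N * (N * residualMatrix N)) i i - 5 * (N * residualMatrix N) i i -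
      ((N * (N * residualMatrix N)).trace - 5 * (N * residualMatrix N).trace) := by
  have h0 := h.trace_residual
  obtain ⟨s, hs⟩ : ∃ s, ∑ k, b k = 2 * s := ⟨(∑ k, b k) / 2, by omega⟩
  obtain ⟨V, hV⟩ := h.exists_even_quotient hs
  refine ⟨?_, ⟨V i i, by rw [hV]; ring⟩, ?_⟩
  · have := h.even_quotient_diag i
    rw [h.residual_apply]
    omega
  have e : N * (N * residualMatrix N) = (5 : ℤ) • (N * residualMatrix N) + (8 : ℤ) • (N * V) := by
    rw [← Matrix.mul_smul, ← Matrix.mul_smul, ← mul_add]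
    congr 1
    ext i j
    simp only [hV, Matrix.add_apply, Matrix.smul_apply, smul_eq_mul]
  have hc := residual_commute (N := N)
  have hsy : (N * V).IsSymm := by
    have e2 : (8 : ℤ) • (N * V) =
        N * (N * residualMatrix N) - (5 : ℤ) • (N * residualMatrix N) := by
      rw [e]; simp
    have e3 : ((8 : ℤ) • (N * V)).IsSymm := by
      rw [e2, IsSymm, transpose_sub, transpose_smul, transpose_mul, transpose_mul,
        h.residual_isSymm.eq, h.isSymm.eq, ← hc, mul_assoc, ← hc]
    ext i j
    have := e3.apply i j
    simpa using this
  have h1 := dvd_sub_sum (fun i j => h.mul_parity_const hsy i j) i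
  have h2 : (N * (N * residualMatrix N)).trace = 5 * (N * residualMatrix N).trace
      + 8 * ∑ i, (N * V) i i := by
    rw [e, trace_add, trace_smul, trace_smul]
    rfl
  rw [h2, e]
  simp only [Matrix.add_apply, Matrix.smul_apply, smul_eq_mul]
  omega

theorem congr_of_trace_mod_eq_seven (ht : (residualMatrix N).trace % 8 = 7) :
    ∃ V : Matrix (Fin 21) (Fin 21) ℤ,
      (∀ i j, (N * residualMatrix N) i j = residualMatrix N i j + 8 * V i j) ∧
      (∀ i, 8 ∣ residualMatrix N i i - 3) ∧ (∀ i, 2 ∣ V i i - V.trace) ∧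
      ∀ i, 2 ∣ (N * V) i i - (N * V).trace := by
  have h0 := h.trace_residual
  obtain ⟨s, hs⟩ : ∃ s, ∑ k, b k = 2 * s + 1 := ⟨(∑ k, b k) / 2, by omega⟩
  obtain ⟨V, hV', hV⟩ := h.exists_odd_quotient hs
  refine ⟨V, hV, fun i => ?_, fun i => dvd_sub_sum hV' i, fun i => ?_⟩
  · have := h.even_quotient_diag i
    rw [h.residual_apply]
    omega
  have e : N * (N * residualMatrix N) = N * residualMatrix N + (8 : ℤ) • (N * V) := by
    rw [← Matrix.mul_smul, ← mul_add]
    congr 1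
    ext i j
    simp only [hV, Matrix.add_apply, Matrix.smul_apply, smul_eq_mul]
  have hc := residual_commute (N := N)
  have hsy : (N * V).IsSymm := by
    have e2 : (8 : ℤ) • (N * V) = N * (N * residualMatrix N) - N * residualMatrix N := by
      rw [e]; simp
    have e3 : ((8 : ℤ) • (N * V)).IsSymm := by
      rw [e2, IsSymm, transpose_sub, transpose_mul, transpose_mul,
        h.residual_isSymm.eq, h.isSymm.eq, ← hc, mul_assoc, ← hc]
    ext i j
    have := e3.apply i j
    simpa using this
  exact dvd_sub_sum (fun i j => h.mul_parity_const hsy i j) i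

theorem residual_mod_four (i j : Fin 21) : residualMatrix N i j % 4 = 3 := by
  rw [h.residual_apply]
  omega

theorem trace_residual_sq :
    32 ∣ (residualMatrix N * residualMatrix N).trace - 2 * (residualMatrix N).trace - 3 := by
  have h1 := h.trace_residual
  have e : (residualMatrix N * residualMatrix N).trace =
      ∑ i, ∑ j, residualMatrix N i j * residualMatrix N i j := by
    simp_rw [trace, diag_apply, mul_apply]
    exact sum_congr rfl fun i _ => sum_congr rfl fun j _ => by
      rw [h.residual_isSymm.apply i j]
  have hW : 2 ∣ ∑ i, ∑ j, quotientMatrix A b i j := by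
    rw [show ∑ i, ∑ j, quotientMatrix A b i j = ∑ j, ∑ i, quotientMatrix A b i j from sum_comm]
    have : ∀ i, 2 ∣ ∑ k, quotientMatrix A b k i - (∑ k, b k + b i + (A *ᵥ b) i) :=
      h.sum_quotient_col
    have h1 : ∑ k, (A *ᵥ b) k = 2 * ∑ k, b k * b k := by
      simp_rw [mulVec, dotProduct]
      rw [sum_comm]
      simp_rw [← sum_mul, h.sum_col, mul_sum]
      exact sum_congr rfl fun k _ => by ring
    have h2 := dvd_sum (s := univ) fun i _ => this i
    rw [sum_sub_distrib, sum_add_distrib, sum_add_distrib, h1] at h2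
    simp at h2
    omega
  set σ := ∑ k, b k with hσ
  have key : ∀ i j, 32 ∣ residualMatrix N i j * residualMatrix N i j -
      ((7 + 4 * σ) ^ 2 + (8 * (7 + 4 * σ) + 16) * (b i + b j) + 16 * quotientMatrix A b i j) := by
    intro i j
    rw [h.residual_apply, ← hσ]
    obtain ⟨c, hc⟩ := (Int.even_mul_pred_self (b i + b j)).two_dvd
    refine ⟨c + 2 * quotientMatrix A b i j ^ 2 + quotientMatrix A b i j * (3 + 2 * σ)
      + 2 * quotientMatrix A b i j * (b i + b j), ?_⟩
    linear_combination 16 * hc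
  have h2 := dvd_sum (s := univ) fun i _ => dvd_sum (s := univ) fun j _ => key i j
  simp_rw [sum_sub_distrib, ← e, sum_add_distrib, ← mul_sum, sum_add_distrib] at h2
  simp only [sum_const, card_univ, Fintype.card_fin, nsmul_eq_mul, ← hσ, ← mul_sum] at h2
  obtain ⟨c, hc⟩ := hW
  obtain ⟨u, hu⟩ := h2
  obtain ⟨v, hv⟩ := h1
  obtain ⟨x, hx⟩ := (Int.even_mul_succ_self σ).two_dvd
  rw [hc] at hu
  push_cast at hu
  exact ⟨666 + 525 * x + 598 * σ + c + u - v, by linear_combination hu - 2 * hv + 8400 * hx⟩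

end IsEvenLineMatrix

theorem four_dvd_sum_sub_prod {ι : Type*} (s : Finset ι) (f : ι → ℤ)
    (hf : ∀ i ∈ s, f i = 1 ∨ f i = -1) :
    4 ∣ ∑ i ∈ s, f i - s.card - ∏ i ∈ s, f i + 1 := by
  suffices h : (∏ i ∈ s, f i = 1 ∨ ∏ i ∈ s, f i = -1) ∧
      4 ∣ ∑ i ∈ s, f i - s.card - ∏ i ∈ s, f i + 1 from h.2
  classical
  induction s using Finset.induction_on with
  | empty => simp
  | insert a s ha ih =>
    obtain ⟨h1, h2⟩ := ih fun i hi => hf i (Finset.mem_insert_of_mem hi)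
    rw [Finset.sum_insert ha, Finset.prod_insert ha, Finset.card_insert_of_notMem ha]
    push_cast
    rcases hf a (Finset.mem_insert_self a s) with h3 | h3 <;> rcases h1 with h1 | h1 <;>
      rw [h3, h1] <;> rw [h1] at h2 <;> refine ⟨by norm_num, by omega⟩

/-- A symmetric sign matrix can be switched so that each row has product `1`. -/
theorem exists_switching {n : Type*} [Fintype n] [DecidableEq n] (hn : Odd (Fintype.card n))
    (s : n → n → ℤ) (hs : ∀ i j, s i j = s j i) (hd : ∀ i, s i i = 1)
    (hpm : ∀ i j, s i j = 1 ∨ s i j = -1) :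
    ∃ ε : n → ℤ, (∀ i, ε i = 1 ∨ ε i = -1) ∧ ∀ i, ∏ j, ε i * ε j * s i j = 1 := by
  have hsq : ∀ i j, s i j * s i j = 1 := fun i j => by rcases hpm i j with h | h <;> simp [h]
  refine ⟨fun i => ∏ j, s i j, fun i => ?_, fun i => ?_⟩
  · refine Finset.prod_induction _ (fun x : ℤ => x = 1 ∨ x = -1) ?_ (Or.inl rfl) fun j _ => hpm i j
    rintro a b (rfl | rfl) (rfl | rfl) <;> simp
  · have h1 : ∏ j, ∏ k, s j k = 1 := by
      rw [← Fintype.prod_prod_type']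
      refine Finset.prod_involution (fun x _ => x.swap) ?_ ?_ ?_ ?_
      · rintro ⟨i, j⟩ -
        simp [hs j i, hsq]
      · rintro ⟨i, j⟩ - h hs
        simp only [Prod.swap_prod_mk, Prod.mk.injEq] at hs
        simp [hs.1, hd] at h
      · simp
      · simp
    rw [Finset.prod_mul_distrib, Finset.prod_mul_distrib, h1]
    simp only [Finset.prod_const, Finset.card_univ, mul_one]
    rw [← pow_succ]
    have h2 : (∏ j, s i j) * ∏ j, s i j = 1 := by
      rw [← Finset.prod_mul_distrib]
      simp [hsq]
    obtain ⟨m, hm⟩ := hn.add_one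
    rw [hm, ← two_mul, pow_mul, sq, h2, one_pow]

theorem exists_isEvenLineMatrix {E : Type*} [NormedAddCommGroup E] [InnerProductSpace ℝ E]
    (x : Fin 21 → E) (hx : ∀ i, ‖x i‖ = 1) (hxx : ∀ i j, i ≠ j → |⟪x i, x j⟫| = 1 / 5) :
    ∃ N A b, IsEvenLineMatrix N A b ∧
      ∃ y : Fin 21 → E, ∀ i j, ⟪y i, y j⟫ = ((N i j : ℝ) + if i = j then 8 else 0) / 5 := by
  classical
  let s : Fin 21 → Fin 21 → ℤ := fun i j => if 0 < ⟪x i, x j⟫ then 1 else -1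
  have hself : ∀ i, ⟪x i, x i⟫ = 1 := fun i => by rw [real_inner_self_eq_norm_sq, hx]; norm_num
  have hpm : ∀ i j, s i j = 1 ∨ s i j = -1 := fun i j => by
    simp only [s]; split_ifs <;> simp
  have hsd : ∀ i, s i i = 1 := fun i => by
    simp only [s, hself, zero_lt_one, if_true]
  have hss : ∀ i j, s i j = s j i := fun i j => by simp only [s, real_inner_comm]
  have hsx : ∀ i j, i ≠ j → ⟪x i, x j⟫ = s i j / 5 := fun i j hij => by
    have h := hxx i j hij
    simp only [s]
    split_ifs with h0
    · rw [abs_of_pos h0] at h; rw [h]; simp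
    · rw [abs_of_nonpos (not_lt.1 h0)] at h; push_cast; linarith
  obtain ⟨ε, hε, hprod⟩ := exists_switching (by decide) s hss hsd hpm
  have hε2 : ∀ i, ε i * ε i = 1 := fun i => by rcases hε i with h | h <;> simp [h]
  have hpm' : ∀ i j, ε i * ε j * s i j = 1 ∨ ε i * ε j * s i j = -1 := fun i j => by
    rcases hε i with h | h <;> rcases hε j with h' | h' <;> rcases hpm i j with h'' | h'' <;>
      simp [h, h', h'']
  have hsum : ∀ i, 4 ∣ ∑ j, ε i * ε j * s i j - 21 := fun i => by
    have := four_dvd_sum_sub_prod Finset.univ (fun j => ε i * ε j * s i j) fun j _ => hpm' i j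
    rw [hprod] at this
    simpa using this
  choose c hc using hsum
  refine ⟨fun i j => ε i * ε j * s i j - if i = j then 4 else 0,
    fun i j => (ε i * ε j * s i j - 1) / 2 - if i = j then 2 else 0, fun i => c i - 1,
    ⟨fun i j => ?_, fun i j => ?_, fun i => ?_, fun i => ?_, fun i j hij => ?_⟩,
    fun i => (ε i : ℝ) • x i, fun i j => ?_⟩
  · rw [hss i j, mul_comm (ε i)]
    simp [eq_comm]
  · rcases hpm' i j with h | h <;> split_ifs <;> simp [h]
  · simp [hε2, hsd]
  · have h1 : ∀ j, ε i * ε j * s i j = 2 * ((ε i * ε j * s i j - 1) / 2) + 1 := fun j => by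
      rcases hpm' i j with h | h <;> rw [h] <;> norm_num
    have h2 : ∑ j, ε i * ε j * s i j = 2 * ∑ j, (ε i * ε j * s i j - 1) / 2 + 21 := by
      rw [Finset.mul_sum]
      conv_lhs => rw [Finset.sum_congr rfl fun j _ => h1 j, Finset.sum_add_distrib]
      simp
    rw [Finset.sum_sub_distrib]
    have := hc i
    simp
    omega
  · simpa [hij] using hpm' i j
  · rw [real_inner_smul_left, real_inner_smul_right]
    by_cases hij : i = j
    · subst hij
      have : (ε i : ℝ) * ε i = 1 := by exact_mod_cast hε2 i
      rw [hself]
      simp only [hε2, hsd, if_true]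
      push_cast
      linarith
    · rw [hsx i j hij]
      simp [hij]
      ring

namespace IsSpectralFrame
open Polynomial

variable {n : Type*} [Fintype n] [DecidableEq n] {N : Matrix n n ℤ} {ev : n → ℝ} {U : n → n → ℝ}
  (h : IsSpectralFrame N ev U)
include h

theorem sum_aeval (p : ℤ[X]) : (((aeval N p).trace : ℤ) : ℝ) = ∑ k, aeval (ev k) p := by
  simp only [Matrix.trace, Matrix.diag_apply, Int.cast_sum, h.entry]
  rw [Finset.sum_comm]
  simp_rw [← Finset.mul_sum, h.orthonormal]
  simp

theorem diag_nonneg {p : ℤ[X]} (hp : ∀ k, 0 ≤ aeval (ev k) p) (i : n) : 0 ≤ aeval N p i i := by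
  have : (0 : ℝ) ≤ (aeval N p i i : ℤ) := by
    rw [h.entry]
    exact Finset.sum_nonneg fun k _ => mul_nonneg (hp k) (mul_self_nonneg _)
  exact_mod_cast this

theorem aeval_eq_zero {p : ℤ[X]} (hp : ∀ k, aeval (ev k) p = 0) : aeval N p = 0 := by
  ext i j
  have := h.entry p i j
  simp only [hp, zero_mul, Finset.sum_const_zero] at this
  exact_mod_cast this

theorem sum_mul_mul (k l : n) :
    ∑ i, ∑ j, U i k * U j l * N i j = if k = l then ev k else 0 := by
  have h1 : ∀ i j, (N i j : ℝ) = ∑ m, ev m * (U i m * U j m) := fun i j => by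
    simpa using h.entry X i j
  calc ∑ i, ∑ j, U i k * U j l * N i j
      = ∑ m, ev m * ((∑ i, U i k * U i m) * ∑ j, U j l * U j m) := by
        simp_rw [h1, Finset.sum_mul_sum, Finset.mul_sum]
        conv_lhs => enter [2, i]; rw [Finset.sum_comm]
        rw [Finset.sum_comm]
        refine Finset.sum_congr rfl fun m _ => ?_
        refine Finset.sum_congr rfl fun i _ => Finset.sum_congr rfl fun j _ => by ring
    _ = _ := by
        simp_rw [h.orthonormal]
        by_cases hkl : k = l
        · simp [hkl]
        · simp [hkl]

theorem inner_sum {E : Type*} [NormedAddCommGroup E] [InnerProductSpace ℝ E] {y : n → E}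
    (hy : ∀ i j, ⟪y i, y j⟫ = ((N i j : ℝ) + if i = j then 8 else 0) / 5) (k l : n) :
    ⟪∑ i, U i k • y i, ∑ i, U i l • y i⟫ = if k = l then (ev k + 8) / 5 else 0 := by
  simp_rw [_root_.sum_inner, _root_.inner_sum, real_inner_smul_left, real_inner_smul_right, hy]
  have h1 : ∀ i j, U i k * (U j l * (((N i j : ℝ) + if i = j then 8 else 0) / 5)) =
      U i k * U j l * N i j / 5 + if i = j then 8 / 5 * (U i k * U i l) else 0 := fun i j => by
    split_ifs with hij
    · subst hij; ring
    · ring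
  simp_rw [h1, Finset.sum_add_distrib, ← Finset.sum_div, h.sum_mul_mul]
  simp only [Finset.sum_ite_eq, Finset.mem_univ, if_true, ← Finset.mul_sum, h.orthonormal]
  split_ifs <;> ring

theorem neg_eight_le {E : Type*} [NormedAddCommGroup E] [InnerProductSpace ℝ E] {y : n → E}
    (hy : ∀ i j, ⟪y i, y j⟫ = ((N i j : ℝ) + if i = j then 8 else 0) / 5) (k : n) :
    -8 ≤ ev k := by
  have h1 := h.inner_sum hy k k
  rw [if_pos rfl] at h1
  have h2 := real_inner_self_nonneg (x := ∑ i, U i k • y i)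
  linarith

theorem card_ne_le {E : Type*} [NormedAddCommGroup E] [InnerProductSpace ℝ E]
    [FiniteDimensional ℝ E] {y : n → E}
    (hy : ∀ i j, ⟪y i, y j⟫ = ((N i j : ℝ) + if i = j then 8 else 0) / 5) :
    (Finset.univ.filter fun k => ev k ≠ -8).card ≤ Module.finrank ℝ E := by
  have h1 : LinearIndependent ℝ fun k : {k // ev k ≠ -8} => ∑ i, U i k • y i := by
    refine linearIndependent_of_ne_zero_of_inner_eq_zero (fun k hk => ?_) fun k l hkl => ?_
    · have h1 := h.inner_sum hy k k
      rw [if_pos rfl, hk, inner_zero_left] at h1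
      exact k.2 (by linarith)
    · change ⟪∑ i, U i k • y i, ∑ i, U i l • y i⟫ = 0
      rw [h.inner_sum hy, if_neg fun h => hkl (Subtype.ext h)]
  have h2 := h1.fintype_card_le_finrank
  rwa [Fintype.card_subtype] at h2

end IsSpectralFrame

/-- The spectral data of the eigenvalues different from `-8`. -/
structure IsLineSpectrum (ev : Fin 21 → ℝ) : Prop where
  neg_eight_le : ∀ k, -8 ≤ ev k
  card_ne : (Finset.univ.filter fun k => ev k ≠ -8).card = 12
  sum_eq : ∑ k, ev k = -63
  sum_sq : ∑ k, ev k ^ 2 = 609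

theorem IsEvenLineMatrix.sq_diag {N A b} (h : IsEvenLineMatrix N A b) (i : Fin 21) :
    (N ^ 2) i i = 29 := by
  have h3 : N i i = -3 := by rw [h.eq_add, h.diag]; norm_num
  rw [sq, Matrix.mul_apply, ← Finset.add_sum_erase _ _ (Finset.mem_univ i), h3]
  rw [Finset.sum_congr rfl (g := fun _ => 1)]
  · simp
  · intro j hj
    have hij := Finset.ne_of_mem_erase hj
    rw [← h.isSymm.apply i j]
    rcases h.off_diag j i hij with h | h <;> rw [h] <;> norm_num

open Polynomial in
theorem IsSpectralFrame.isLineSpectrum {N A b ev U} (hN : IsEvenLineMatrix N A b)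
    (h : IsSpectralFrame N ev U) {y : Fin 21 → EuclideanSpace ℝ (Fin 12)}
    (hy : ∀ i j, ⟪y i, y j⟫ = ((N i j : ℝ) + if i = j then 8 else 0) / 5) :
    IsLineSpectrum ev := by
  have h1 : ∑ k, ev k = -63 := by
    have := h.sum_aeval X
    have e : N.trace = -63 := by
      simp [Matrix.trace, hN.eq_add, hN.diag]
    simp only [aeval_X, e] at this
    rw [← this]; norm_num
  have h2 : ∑ k, ev k ^ 2 = 609 := by
    have := h.sum_aeval (X ^ 2)
    have e : (N ^ 2).trace = 609 := by
      simp [Matrix.trace, hN.sq_diag]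
    simp only [map_pow, aeval_X, e] at this
    rw [← this]; norm_num
  refine ⟨h.neg_eight_le hy, le_antisymm ?_ ?_, h1, h2⟩
  · simpa using h.card_ne_le hy
  · set S := Finset.univ.filter fun k => ev k ≠ -8 with hS
    have e1 : ∑ k ∈ S, (ev k + 8) = 105 := by
      rw [hS, Finset.sum_filter_of_ne (by intro k _ hk hk'; exact hk (by rw [hk']; norm_num))]
      rw [Finset.sum_add_distrib, h1]
      norm_num
    have e2 : ∑ k ∈ S, (ev k + 8) ^ 2 = 945 := by
      rw [hS, Finset.sum_filter_of_ne (by intro k _ hk hk'; exact hk (by rw [hk']; norm_num))]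
      simp_rw [add_sq, Finset.sum_add_distrib, h2, ← Finset.sum_mul, ← Finset.mul_sum, h1]
      norm_num
    have e3 := sq_sum_le_card_mul_sum_sq (s := S) (f := fun k => ev k + 8)
    rw [e1, e2] at e3
    by_contra hlt
    have : (S.card : ℝ) ≤ 11 := by exact_mod_cast (by omega : S.card ≤ 11)
    nlinarith

theorem exists_spectral_data {x : Fin 21 → EuclideanSpace ℝ (Fin 12)} (hx : ∀ i, ‖x i‖ = 1)
    (hxx : ∀ i j, i ≠ j → |⟪x i, x j⟫| = 1 / 5) :
    ∃ N A b ev U, IsEvenLineMatrix N A b ∧ IsSpectralFrame N ev U ∧ IsLineSpectrum ev := by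
  obtain ⟨N, A, b, hN, y, hy⟩ := exists_isEvenLineMatrix x hx hxx
  obtain ⟨ev, U, h⟩ := IsSpectralFrame.exists_of_isSymm N hN.isSymm
  exact ⟨N, A, b, ev, U, hN, h, h.isLineSpectrum hN hy⟩

theorem Matrix.pow_dvd_det_of_dvd_row_sub {R : Type*} [CommRing R] {n : ℕ} (t : R)
    (M : Matrix (Fin (n + 1)) (Fin (n + 1)) R) (h : ∀ i j, t ∣ M i j - M 0 j) :
    t ^ n ∣ M.det := by
  choose B hB using h
  let B' : Matrix (Fin (n + 1)) (Fin (n + 1)) R := Matrix.of (Fin.cons (M 0) fun i => B i.succ)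
  refine ⟨B'.det, ?_⟩
  rw [Matrix.det_eq_of_forall_row_eq_smul_add_const
    (A := M) (B := Matrix.diagonal (Fin.cons (1 : R) fun _ => t) * B')
    (Fin.cons (0 : R) fun _ => 1) 0 (Fin.cons_zero _ _), Matrix.det_mul, Matrix.det_diagonal]
  · simp [Fin.prod_univ_succ]
  · intro i j
    rw [Matrix.diagonal_mul, Matrix.diagonal_mul]
    refine Fin.cases ?_ (fun i => ?_) i
    · simp [B']
    · simp [B', ← hB]

open Polynomial in
theorem IsEvenLineMatrix.exists_charpoly_comp_eq {N A b} (h : IsEvenLineMatrix N A b) :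
    ∃ g : ℤ[X], N.charpoly.comp (C 2 * X) = C 2 ^ 20 * g := by
  rw [Matrix.charpoly, ← coe_compRingHom_apply, RingHom.map_det]
  refine Matrix.pow_dvd_det_of_dvd_row_sub _ _ fun i j => ?_
  have hM : ∀ i j, (compRingHom (C 2 * X)).mapMatrix N.charmatrix i j =
      C 2 * ((if i = j then X else 0) - C (A i j)) - 1 := by
    intro i j
    rw [RingHom.mapMatrix_apply, Matrix.map_apply, Matrix.charmatrix_apply, coe_compRingHom_apply,
      h.eq_add, Matrix.diagonal_apply]
    split_ifs
    · simp; ring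
    · simp; ring
  rw [hM, hM]
  exact ⟨_, by rw [sub_sub_sub_cancel_right, ← mul_sub]⟩

/-- Indices of the eigenvalues different from `-8`, `0` and `2`. -/
noncomputable def freeIndices (ev : Fin 21 → ℝ) : Finset (Fin 21) :=
  Finset.univ.filter fun k => ev k ≠ -8 ∧ ev k ≠ 0 ∧ ev k ≠ 2

open Polynomial in
theorem exists_int_free_poly {N A b ev U} (hN : IsEvenLineMatrix N A b)
    (h : IsSpectralFrame N ev U) :
    ∃ p : ℤ[X], p.map (Int.castRingHom ℝ) = C 2 * ∏ k ∈ freeIndices ev, (X - C (ev k / 2)) := by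
  classical
  obtain ⟨g, hg⟩ := hN.exists_charpoly_comp_eq
  have h1 : g.map (Int.castRingHom ℝ) = C 2 * ∏ k, (X - C (ev k / 2)) := by
    have h2 := congrArg (Polynomial.map (Int.castRingHom ℝ)) hg
    have h5 : (C 2 : ℤ[X]).map (Int.castRingHom ℝ) = C 2 := by rw [map_C]; simp
    rw [Polynomial.map_comp, h.charpoly, Polynomial.prod_comp, Polynomial.map_mul,
      Polynomial.map_mul, Polynomial.map_pow, h5, map_X] at h2
    have h3 : ∀ k, (X - C (ev k)).comp (C 2 * X) =
        C 2 * (X - C (ev k / 2)) := fun k => by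
      have : C (ev k) = (C 2 * C (ev k / 2) : ℝ[X]) := by rw [← C_mul]; congr 1; ring
      rw [sub_comp, X_comp, C_comp, this]
      ring
    simp_rw [h3, Finset.prod_mul_distrib] at h2
    simp only [Finset.prod_const, Finset.card_univ, Fintype.card_fin] at h2
    have h4 : (C 2 ^ 20 : ℝ[X]) ≠ 0 := pow_ne_zero _ (C_ne_zero.2 (by norm_num))
    apply mul_left_cancel₀ h4
    rw [← h2, pow_succ, mul_assoc]
  let c : Fin 21 → ℤ := fun k => if ev k = -8 then -4 else if ev k = 0 then 0 else 1
  have hc : ∀ k ∈ (freeIndices ev)ᶜ, ev k / 2 = c k := by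
    intro k hk
    simp only [freeIndices, Finset.mem_compl, Finset.mem_filter, Finset.mem_univ, true_and] at hk
    simp only [c]
    split_ifs with h1 h2
    · rw [h1]; norm_num
    · rw [h2]; norm_num
    · have : ev k = 2 := by tauto
      rw [this]; norm_num
  have hD : (∏ k ∈ (freeIndices ev)ᶜ, (X - C (c k))).Monic :=
    monic_prod_of_monic _ _ fun k _ => monic_X_sub_C _
  refine ⟨g /ₘ ∏ k ∈ (freeIndices ev)ᶜ, (X - C (c k)), ?_⟩
  rw [map_divByMonic _ hD, h1, ← Finset.prod_mul_prod_compl (freeIndices ev)]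
  have h2 : ∏ k ∈ (freeIndices ev)ᶜ, (X - C (ev k / 2)) =
      (∏ k ∈ (freeIndices ev)ᶜ, (X - C (c k))).map (Int.castRingHom ℝ) := by
    rw [Polynomial.map_prod]
    refine Finset.prod_congr rfl fun k hk => ?_
    rw [hc k hk]
    simp
  rw [h2, ← mul_assoc, mul_comm, mul_divByMonic_cancel_left _ (hD.map _)]

open Polynomial in
theorem exists_int_free_prods {N A b ev U} (hN : IsEvenLineMatrix N A b)
    (h : IsSpectralFrame N ev U) :
    ∃ p q : ℤ, (p : ℝ) = 2 * ∏ k ∈ freeIndices ev, (-ev k / 2) ∧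
      (q : ℝ) = 2 * ∏ k ∈ freeIndices ev, (1 - ev k / 2) := by
  obtain ⟨f, hf⟩ := exists_int_free_poly hN h
  have key : ∀ t : ℤ, ((f.eval t : ℤ) : ℝ) = 2 * ∏ k ∈ freeIndices ev, (t - ev k / 2) := fun t => by
    have := congrArg (Polynomial.eval (t : ℝ)) hf
    rw [eval_intCast_map] at this
    simpa [eval_prod] using this
  refine ⟨f.eval 0, f.eval 1, ?_, ?_⟩
  · rw [key]
    congr 1
    exact Finset.prod_congr rfl fun k _ => by push_cast; ring
  · rw [key]
    simp

section ExpBounds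

open Real Finset

theorem exp_five_quarters_lt : exp (5 / 4) < 4 := by
  have h1 := exp_one_lt_d9
  have h2 : exp (1 / 4) ^ 4 = exp 1 := by rw [← exp_nat_mul]; norm_num
  have h3 : exp (1 / 4) < 1.4 := by
    by_contra h
    have h5 : (1.4 : ℝ) ^ 4 ≤ exp (1 / 4) ^ 4 := pow_le_pow_left₀ (by norm_num) (not_lt.1 h) 4
    rw [h2] at h5
    norm_num at h5 h1
    linarith
  have h4 : exp (5 / 4) = exp 1 * exp (1 / 4) := by rw [← exp_add]; norm_num
  rw [h4]
  nlinarith [exp_pos 1, exp_pos (1 / 4)]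

theorem abs_lt_exp_sub_one_of_neg {x : ℝ} (hx : -1 / 4 ≤ x) (h0 : x < 0) :
    |x| < exp (x - 1) := by
  rw [abs_of_neg h0]
  have h1 : exp (-(5 / 4)) ≤ exp (x - 1) := exp_le_exp.2 (by linarith)
  have h2 : 1 / 4 < exp (-(5 / 4)) := by
    rw [exp_neg, one_div]
    exact inv_strictAnti₀ (exp_pos _) exp_five_quarters_lt
  linarith

theorem abs_le_exp_sub_one {x : ℝ} (hx : -1 / 4 ≤ x) : |x| ≤ exp (x - 1) := by
  rcases lt_or_ge x 0 with h | h
  · exact (abs_lt_exp_sub_one_of_neg hx h).le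
  · rw [abs_of_nonneg h]
    linarith [add_one_le_exp (x - 1)]

theorem prod_abs_le_exp {ι : Type*} (s : Finset ι) (x : ι → ℝ) (hx : ∀ k ∈ s, -1 / 4 ≤ x k) :
    ∏ k ∈ s, |x k| ≤ exp (∑ k ∈ s, x k - s.card) := by
  calc ∏ k ∈ s, |x k| ≤ ∏ k ∈ s, exp (x k - 1) :=
        prod_le_prod (fun _ _ => abs_nonneg _) fun k hk => abs_le_exp_sub_one (hx k hk)
    _ = exp (∑ k ∈ s, x k - s.card) := by
        rw [← exp_sum, sum_sub_distrib]; simp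

theorem exists_eq_neg_quarter_of_prod {ι : Type*} [DecidableEq ι] (s : Finset ι) (x : ι → ℝ)
    (hcard : s.card = 5) (hx : ∀ k ∈ s, -1 / 4 ≤ x k) (hx0 : ∀ k ∈ s, x k ≠ 0)
    (hsum : ∑ k ∈ s, x k = 15 / 4) (hprod : 1 / 4 ≤ ∏ k ∈ s, |x k|) :
    ∃ k ∈ s, x k = -1 / 4 ∧ ∀ l ∈ s.erase k, x l = 1 := by
  obtain ⟨k, hk, hk0⟩ : ∃ k ∈ s, x k < 0 := by
    by_contra! hpos
    have h1 : ∏ k ∈ s, |x k| ≤ ∏ k ∈ s, (3 / 4 * exp (4 / 3 * x k - 1)) := by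
      refine prod_le_prod (fun _ _ => abs_nonneg _) fun k hk => ?_
      rw [abs_of_nonneg (hpos k hk)]
      linarith [add_one_le_exp (4 / 3 * x k - 1)]
    rw [prod_mul_distrib, ← exp_sum, sum_sub_distrib, ← mul_sum, hsum] at h1
    simp [hcard] at h1
    norm_num at h1
    linarith
  refine ⟨k, hk, ?_⟩
  have hc' : (s.erase k).card = 4 := by rw [card_erase_of_mem hk, hcard]
  have hs' : ∑ l ∈ s.erase k, x l = 15 / 4 - x k := by
    rw [← hsum, ← add_sum_erase s x hk]; ring
  have hb := prod_abs_le_exp (s.erase k) x fun l hl => hx l (mem_of_mem_erase hl)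
  rw [← mul_prod_erase s _ hk, abs_of_neg hk0] at hprod
  rw [hs', hc'] at hb
  have hlow := hx k hk
  have hle : exp (15 / 4 - x k - (4 : ℕ)) ≤ 1 := by
    rw [exp_le_one_iff]; push_cast; linarith
  have hxk : x k = -1 / 4 := by nlinarith
  refine ⟨hxk, ?_⟩
  have h1 : 1 ≤ ∏ l ∈ s.erase k, |x l| := by rw [hxk] at hprod; linarith
  have heq : ∀ l ∈ s.erase k, |x l| = exp (x l - 1) := by
    by_contra! hne
    obtain ⟨l, hl, hne⟩ := hne
    have hle : ∀ l ∈ s.erase k, |x l| ≤ exp (x l - 1) := fun l hl =>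
      abs_le_exp_sub_one (hx l (mem_of_mem_erase hl))
    have h2 := prod_lt_prod (fun l hl => abs_pos.2 (hx0 l (mem_of_mem_erase hl))) hle
      ⟨l, hl, lt_of_le_of_ne (hle l hl) hne⟩
    rw [← exp_sum, sum_sub_distrib, hs', hxk] at h2
    simp [hc'] at h2
    norm_num at h2
    linarith
  intro l hl
  have h2 := heq l hl
  rcases lt_or_ge (x l) 0 with h | h
  · exact absurd h2 (abs_lt_exp_sub_one_of_neg (hx l (mem_of_mem_erase hl)) h).ne
  · rw [abs_of_nonneg h] at h2
    by_contra h3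
    linarith [add_one_lt_exp (sub_ne_zero.2 h3)]

end ExpBounds

open Polynomial in
/-- The polynomial `X (X - 2) (X + 8)`. -/
noncomputable def residualPoly : ℤ[X] := X ^ 3 + (6 : ℤ) • X ^ 2 - (16 : ℤ) • X

open Polynomial in
theorem aeval_residualPoly (N : Matrix (Fin 21) (Fin 21) ℤ) :
    aeval N residualPoly = residualMatrix N := by
  simp only [residualPoly, residualMatrix, map_sub, map_add, map_smul, map_pow, aeval_X]

open Polynomial in
theorem aeval_real_residualPoly (t : ℝ) :
    aeval t residualPoly = t * (t - 2) * (t + 8) := by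
  simp only [residualPoly, map_sub, map_add, map_smul, map_pow, aeval_X]
  simp only [zsmul_eq_mul]
  push_cast
  ring

section FreeSums

variable {N A : Matrix (Fin 21) (Fin 21) ℤ} {b : Fin 21 → ℤ} {ev : Fin 21 → ℝ}
  {U : Fin 21 → Fin 21 → ℝ}

theorem IsLineSpectrum.exists_sum_eq (hS : IsLineSpectrum ev) :
    ∃ k l : ℕ, (freeIndices ev).card + k + l = 12 ∧ ∀ g : ℝ → ℝ,
      ∑ i, g (ev i) = 9 * g (-8) + k * g 0 + l * g 2 + ∑ i ∈ freeIndices ev, g (ev i) := by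
  classical
  set S := Finset.univ.filter fun k => ev k ≠ -8 with hSdef
  have hS' : (Finset.univ.filter fun k => ¬ ev k ≠ -8).card = 9 := by
    have h1 := Finset.card_filter_add_card_filter_not (s := Finset.univ) fun k => ev k ≠ -8
    have h2 := hS.card_ne
    simp only [Finset.card_univ, Fintype.card_fin] at h1
    omega
  have hF : freeIndices ev = (S.filter fun k => ¬ ev k = 0).filter fun k => ¬ ev k = 2 := by
    ext k; simp [freeIndices, hSdef, and_assoc]
  refine ⟨(S.filter fun k => ev k = 0).card,
    ((S.filter fun k => ¬ ev k = 0).filter fun k => ev k = 2).card, ?_, fun g => ?_⟩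
  · have h1 := Finset.card_filter_add_card_filter_not (s := S) fun k => ev k = 0
    have h2 := Finset.card_filter_add_card_filter_not (s := S.filter fun k => ¬ ev k = 0)
      fun k => ev k = 2
    have h3 := hS.card_ne
    rw [← hF] at h2
    rw [← hSdef] at h3
    omega
  · rw [← Finset.sum_filter_add_sum_filter_not Finset.univ fun k => ev k ≠ -8, ← hSdef,
      ← Finset.sum_filter_add_sum_filter_not S fun k => ev k = 0,
      ← Finset.sum_filter_add_sum_filter_not (S.filter fun k => ¬ ev k = 0) fun k => ev k = 2,
      ← hF]
    have e1 : ∑ i with ¬ ev i ≠ -8, g (ev i) = 9 * g (-8) := by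
      rw [Finset.sum_congr rfl (g := fun _ => g (-8)), Finset.sum_const, hS']
      · simp
      · intro i hi
        rw [not_not.1 (Finset.mem_filter.1 hi).2]
    have e2 : ∑ i ∈ S with ev i = 0, g (ev i) = (S.filter fun k => ev k = 0).card * g 0 := by
      rw [Finset.sum_congr rfl (g := fun _ => g 0), Finset.sum_const, nsmul_eq_mul]
      intro i hi
      rw [(Finset.mem_filter.1 hi).2]
    have e3 : ∑ i ∈ S.filter (fun k => ¬ ev k = 0) with ev i = 2, g (ev i) =
        ((S.filter fun k => ¬ ev k = 0).filter fun k => ev k = 2).card * g 2 := by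
      rw [Finset.sum_congr rfl (g := fun _ => g 2), Finset.sum_const, nsmul_eq_mul]
      intro i hi
      rw [(Finset.mem_filter.1 hi).2]
    rw [e1, e2, e3]
    ring

theorem IsLineSpectrum.sum_free_of_vanish (hS : IsLineSpectrum ev) (g : ℝ → ℝ) (h8 : g (-8) = 0)
    (h0 : g 0 = 0) (h2 : g 2 = 0) : ∑ i, g (ev i) = ∑ i ∈ freeIndices ev, g (ev i) := by
  obtain ⟨k, l, -, h⟩ := hS.exists_sum_eq
  rw [h g, h8, h0, h2]
  ring

/-- The traces of `N (N - 2) (N + 8) Nⁿ` for `n = 0, 1, 2`. -/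
structure HasTraces (N : Matrix (Fin 21) (Fin 21) ℤ) (t₀ t₁ t₂ : ℤ) : Prop where
  zero : (residualMatrix N).trace = t₀
  one : (N * residualMatrix N).trace = t₁
  two : (N * (N * residualMatrix N)).trace = t₂

open Polynomial in
theorem hasTraces_of_sum_eq (h : IsSpectralFrame N ev U) (hS : IsLineSpectrum ev) {t₀ t₁ t₂ : ℤ}
    (h0 : ∑ i ∈ freeIndices ev, ev i * (ev i - 2) * (ev i + 8) = t₀)
    (h1 : ∑ i ∈ freeIndices ev, ev i * (ev i * (ev i - 2) * (ev i + 8)) = t₁)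
    (h2 : ∑ i ∈ freeIndices ev, ev i * (ev i * (ev i * (ev i - 2) * (ev i + 8))) = t₂) :
    HasTraces N t₀ t₁ t₂ := by
  have e0 := h.sum_aeval residualPoly
  have e1 := h.sum_aeval (X * residualPoly)
  have e2 := h.sum_aeval (X * (X * residualPoly))
  simp only [map_mul, aeval_X, aeval_residualPoly, aeval_real_residualPoly] at e0 e1 e2
  rw [hS.sum_free_of_vanish (fun t => t * (t - 2) * (t + 8)) (by norm_num) (by norm_num)
    (by norm_num), h0] at e0
  rw [hS.sum_free_of_vanish (fun t => t * (t * (t - 2) * (t + 8))) (by norm_num) (by norm_num)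
    (by norm_num), h1] at e1
  rw [hS.sum_free_of_vanish (fun t => t * (t * (t * (t - 2) * (t + 8)))) (by norm_num) (by norm_num)
    (by norm_num), h2] at e2
  exact ⟨by exact_mod_cast e0, by exact_mod_cast e1, by exact_mod_cast e2⟩

open Polynomial in
theorem IsEvenLineMatrix.dvd_of_sum_eq (hN : IsEvenLineMatrix N A b) (h : IsSpectralFrame N ev U)
    (hS : IsLineSpectrum ev) {t s : ℤ}
    (ht : ∑ i ∈ freeIndices ev, ev i * (ev i - 2) * (ev i + 8) = t)
    (hs : ∑ i ∈ freeIndices ev, (ev i * (ev i - 2) * (ev i + 8)) ^ 2 = (s : ℝ)) :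
    32 ∣ s - 2 * t - 3 := by
  have e0 := h.sum_aeval residualPoly
  have e1 := h.sum_aeval (residualPoly * residualPoly)
  simp only [map_mul, aeval_residualPoly, aeval_real_residualPoly] at e0 e1
  rw [hS.sum_free_of_vanish (fun t => t * (t - 2) * (t + 8)) (by norm_num) (by norm_num)
    (by norm_num), ht] at e0
  rw [hS.sum_free_of_vanish (fun t => t * (t - 2) * (t + 8) * (t * (t - 2) * (t + 8)))
    (by norm_num) (by norm_num) (by norm_num)] at e1
  simp only [← sq] at e1
  rw [hs] at e1
  have h1 := hN.trace_residual_sq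
  rw [sq] at e1
  rwa [Int.cast_injective e0, Int.cast_injective e1] at h1

/-- The free eigenvalues of a line matrix: their number `r`, power sums, and the integers obtained
by evaluating the (rescaled) free factor of the characteristic polynomial at `0` and `1`. -/
theorem exists_free_data (hN : IsEvenLineMatrix N A b) (h : IsSpectralFrame N ev U)
    (hS : IsLineSpectrum ev) :
    ∃ e p q : ℤ, e ≤ 4 ∧ -8 ≤ e ∧ p ≠ 0 ∧ q ≠ 0 ∧
      ∑ i ∈ freeIndices ev, ev i = 2 * e + 1 ∧
      ∑ i ∈ freeIndices ev, ev i ^ 2 = 17 + 4 * e ∧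
      (p : ℝ) = 2 * ∏ k ∈ freeIndices ev, (-ev k / 2) ∧
      (q : ℝ) = 2 * ∏ k ∈ freeIndices ev, (1 - ev k / 2) := by
  obtain ⟨k, l, hkl, hsum⟩ := hS.exists_sum_eq
  obtain ⟨p, q, hp, hq⟩ := exists_int_free_prods hN h
  have hmem : ∀ i ∈ freeIndices ev, ev i ≠ 0 ∧ ev i ≠ 2 := fun i hi =>
    (Finset.mem_filter.1 hi).2.2
  refine ⟨4 - l, p, q, by omega, by omega, ?_, ?_, ?_, ?_, hp, hq⟩
  · rintro rfl
    rw [Int.cast_zero, zero_eq_mul, Finset.prod_eq_zero_iff] at hp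
    obtain ⟨i, hi, h0⟩ := hp.resolve_left two_ne_zero
    exact (hmem i hi).1 (by linarith)
  · rintro rfl
    rw [Int.cast_zero, zero_eq_mul, Finset.prod_eq_zero_iff] at hq
    obtain ⟨i, hi, h0⟩ := hq.resolve_left two_ne_zero
    exact (hmem i hi).2 (by linarith)
  · have h1 := hsum fun t => t
    rw [hS.sum_eq] at h1
    push_cast
    linarith
  · have h1 := hsum fun t => t ^ 2
    rw [hS.sum_sq] at h1
    push_cast
    linarith

theorem free_prod_bound {e p q : ℤ} (hp0 : p ≠ 0) (hq0 : q ≠ 0)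
    (h1 : ∑ i ∈ freeIndices ev, ev i = 2 * e + 1)
    (h2 : ∑ i ∈ freeIndices ev, ev i ^ 2 = 17 + 4 * e)
    (hp : (p : ℝ) = 2 * ∏ k ∈ freeIndices ev, (-ev k / 2))
    (hq : (q : ℝ) = 2 * ∏ k ∈ freeIndices ev, (1 - ev k / 2)) :
    ∑ i ∈ freeIndices ev, ev i * (ev i - 2) / 4 = 15 / 4 ∧
    (1 : ℝ) ≤ |p * q| ∧ (|p * q| : ℝ) = 4 * ∏ k ∈ freeIndices ev, |ev k * (ev k - 2) / 4| ∧
    (|p * q| : ℝ) ≤ 4 * Real.exp (15 / 4 - (freeIndices ev).card) := by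
  have e1 : ∑ i ∈ freeIndices ev, ev i * (ev i - 2) / 4 = 15 / 4 := by
    rw [← Finset.sum_div]
    have : ∀ i, ev i * (ev i - 2) = ev i ^ 2 - 2 * ev i := fun i => by ring
    simp_rw [this, Finset.sum_sub_distrib, ← Finset.mul_sum, h1, h2]
    ring
  have e2 : (|p * q| : ℝ) = 4 * ∏ k ∈ freeIndices ev, |ev k * (ev k - 2) / 4| := by
    rw [hp, hq, ← Finset.abs_prod, mul_mul_mul_comm, ← Finset.prod_mul_distrib, abs_mul]
    congr 1
    · norm_num
    · exact congrArg _ (Finset.prod_congr rfl fun k _ => by ring)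
  refine ⟨e1, ?_, e2, ?_⟩
  · exact_mod_cast Int.one_le_abs (mul_ne_zero hp0 hq0)
  · rw [e2, ← e1]
    have := prod_abs_le_exp (freeIndices ev) (fun k => ev k * (ev k - 2) / 4)
      fun k _ => by nlinarith [sq_nonneg (ev k - 1)]
    linarith

end FreeSums

/-- Every eigenvalue is `-8`, `0`, `2` or a root of `X³ + aX² + bX + d`, and the traces of
`N (N - 2) (N + 8) Nⁿ` are prescribed for `n = 0, 1, 2`. -/
structure CubicCase (N : Matrix (Fin 21) (Fin 21) ℤ) (ev : Fin 21 → ℝ)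
    (a b d t₀ t₁ t₂ : ℤ) : Prop extends HasTraces N t₀ t₁ t₂ where
  root : ∀ k, ev k = -8 ∨ ev k = 0 ∨ ev k = 2 ∨ ev k ^ 3 + a * ev k ^ 2 + b * ev k + d = 0

theorem exists_three_of_card {ι : Type*} {s : Finset ι} (hs : s.card = 3) :
    ∃ a b c, (∀ k ∈ s, k = a ∨ k = b ∨ k = c) ∧ (∀ g : ι → ℝ, ∑ k ∈ s, g k = g a + g b + g c) ∧
      ∀ g : ι → ℝ, ∏ k ∈ s, g k = g a * g b * g c := by
  classical
  obtain ⟨a, b, c, hab, hac, hbc, rfl⟩ := Finset.card_eq_three.1 hs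
  refine ⟨a, b, c, by simp, fun g => ?_, fun g => ?_⟩
  · rw [Finset.sum_insert (by simp [hab, hac]), Finset.sum_pair hbc]; ring
  · rw [Finset.prod_insert (by simp [hab, hac]), Finset.prod_pair hbc]; ring

theorem exists_four_of_card {ι : Type*} {s : Finset ι} (hs : s.card = 4) :
    ∃ a b c d, (∀ k ∈ s, k = a ∨ k = b ∨ k = c ∨ k = d) ∧
      (∀ g : ι → ℝ, ∑ k ∈ s, g k = g a + g b + g c + g d) ∧
      ∀ g : ι → ℝ, ∏ k ∈ s, g k = g a * g b * g c * g d := by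
  classical
  obtain ⟨a, t, ha, rfl, ht⟩ := Finset.card_eq_succ.1 hs
  obtain ⟨b, c, d, h1, h2, h3⟩ := exists_three_of_card ht
  refine ⟨a, b, c, d, fun k hk => ?_, fun g => ?_, fun g => ?_⟩
  · rcases Finset.mem_insert.1 hk with h | h
    · exact Or.inl h
    · exact Or.inr (h1 k h)
  · rw [Finset.sum_insert ha, h2]; ring
  · rw [Finset.prod_insert ha, h3]; ring

theorem forall_of_free {ev : Fin 21 → ℝ} {P : ℝ → Prop} (h : ∀ k ∈ freeIndices ev, P (ev k)) :
    ∀ k, ev k = -8 ∨ ev k = 0 ∨ ev k = 2 ∨ P (ev k) := by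
  intro k
  by_cases hk : k ∈ freeIndices ev
  · exact Or.inr (Or.inr (Or.inr (h k hk)))
  · simp only [freeIndices, Finset.mem_filter, Finset.mem_univ, true_and] at hk
    tauto

section Classification

variable {N A : Matrix (Fin 21) (Fin 21) ℤ} {b : Fin 21 → ℤ} {ev : Fin 21 → ℝ}
  {U : Fin 21 → Fin 21 → ℝ}

theorem classify_one (h : IsSpectralFrame N ev U) (hS : IsLineSpectrum ev) {e : ℤ}
    (h1 : ∑ i ∈ freeIndices ev, ev i = 2 * e + 1)
    (h2 : ∑ i ∈ freeIndices ev, ev i ^ 2 = 17 + 4 * e) (hr : (freeIndices ev).card = 1) :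
    (HasTraces N 195 975 4875 ∧ ∀ k, ev k = -8 ∨ ev k = 0 ∨ ev k = 2 ∨ ev k = 5) ∨
    (HasTraces N 75 (-225) 675 ∧ ∀ k, ev k = -8 ∨ ev k = 0 ∨ ev k = 2 ∨ ev k = -3) := by
  obtain ⟨a, ha⟩ := Finset.card_eq_one.1 hr
  rw [ha, Finset.sum_singleton] at h1 h2
  have h3 : ((e - 2 : ℤ) : ℝ) * (e + 2 : ℤ) = 0 := by
    rw [h1] at h2; push_cast; nlinarith
  have h4 : (e - 2) * (e + 2) = 0 := by exact_mod_cast h3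
  rcases mul_eq_zero.1 h4 with h5 | h5
  · obtain rfl : e = 2 := by omega
    have hx : ev a = 5 := by rw [h1]; norm_num
    refine Or.inl ⟨hasTraces_of_sum_eq h hS ?_ ?_ ?_, forall_of_free (P := (· = 5)) fun k hk => ?_⟩
    all_goals try (rw [ha, Finset.sum_singleton, hx]; norm_num)
    rw [ha, Finset.mem_singleton] at hk
    rw [hk, hx]
  · obtain rfl : e = -2 := by omega
    have hx : ev a = -3 := by rw [h1]; norm_num
    refine Or.inr ⟨hasTraces_of_sum_eq h hS ?_ ?_ ?_, forall_of_free (P := (· = -3)) fun k hk => ?_⟩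
    all_goals try (rw [ha, Finset.sum_singleton, hx]; norm_num)
    rw [ha, Finset.mem_singleton] at hk
    rw [hk, hx]

theorem classify_two (h : IsSpectralFrame N ev U) (hS : IsLineSpectrum ev) {e : ℤ}
    (h1 : ∑ i ∈ freeIndices ev, ev i = 2 * e + 1)
    (h2 : ∑ i ∈ freeIndices ev, ev i ^ 2 = 17 + 4 * e) (hr : (freeIndices ev).card = 2) :
    (HasTraces N 111 39 927 ∧
      ∀ k, ev k = -8 ∨ ev k = 0 ∨ ev k = 2 ∨ ev k ^ 2 = ev k + 8) ∨
    (HasTraces N 159 519 2511 ∧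
      ∀ k, ev k = -8 ∨ ev k = 0 ∨ ev k = 2 ∨ ev k ^ 2 = 3 * ev k + 6) := by
  obtain ⟨i, j, hij, hF⟩ := Finset.card_eq_two.1 hr
  have hi : i ∈ freeIndices ev := by rw [hF]; simp
  have hj : j ∈ freeIndices ev := by rw [hF]; simp
  obtain ⟨-, hx0, hx2⟩ := (Finset.mem_filter.1 hi).2
  obtain ⟨-, hy0, hy2⟩ := (Finset.mem_filter.1 hj).2
  have hs : ∀ g : Fin 21 → ℝ, ∑ k ∈ freeIndices ev, g k = g i + g j := fun g => by
    rw [hF, Finset.sum_pair hij]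
  have hm : ∀ k ∈ freeIndices ev, k = i ∨ k = j := fun k hk => by simpa [hF] using hk
  rw [hs] at h1 h2
  generalize hx : ev i = x at *
  generalize hy : ev j = y at *
  have hxy : x * y = 2 * (e - 2) * (e + 2) := by
    obtain rfl : y = 2 * e + 1 - x := by linarith
    nlinarith
  have hxy' : (2 - x) * (2 - y) = 2 * (e - 3) * (e + 1) := by
    linear_combination hxy - 2 * h1
  have hlow : (4 * e ^ 2 - 4 * e - 33 : ℝ) ≤ 0 := by nlinarith [sq_nonneg (x - y)]
  have hlow' : 4 * e ^ 2 - 4 * e - 33 ≤ 0 := by exact_mod_cast hlow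
  have he1 : -3 < e := by nlinarith
  have he2 : e < 4 := by nlinarith
  have hp := mul_ne_zero hx0 hy0
  have hq := mul_ne_zero (sub_ne_zero.2 hx2.symm) (sub_ne_zero.2 hy2.symm)
  rw [hxy] at hp
  rw [hxy'] at hq
  obtain rfl | rfl : e = 0 ∨ e = 1 := by
    have n1 : e ≠ 2 := by rintro rfl; norm_num at hp
    have n2 : e ≠ -2 := by rintro rfl; norm_num at hp
    have n3 : e ≠ 3 := by rintro rfl; norm_num at hq
    have n4 : e ≠ -1 := by rintro rfl; norm_num at hq
    omega
  · left
    norm_num at h1 h2 hxy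
    have hxx : x ^ 2 = x + 8 := by linear_combination x * h1 - hxy
    have hyy : y ^ 2 = y + 8 := by linear_combination y * h1 - hxy
    refine ⟨hasTraces_of_sum_eq h hS ?_ ?_ ?_, forall_of_free
      (P := fun t => t ^ 2 = t + 8) fun k hk => ?_⟩
    · rw [hs, hx, hy]; push_cast
      linear_combination (x + 7) * hxx + (y + 7) * hyy - h1
    · rw [hs, hx, hy]; push_cast
      linear_combination (x ^ 2 + 7 * x - 1) * hxx + (y ^ 2 + 7 * y - 1) * hyy + 55 * h1
    · rw [hs, hx, hy]; push_cast
      linear_combination (x ^ 3 + 7 * x ^ 2 - x + 55) * hxx + (y ^ 3 + 7 * y ^ 2 - y + 55) * hyy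
        + 47 * h1
    · rcases hm k hk with rfl | rfl
      · rw [hx, hxx]
      · rw [hy, hyy]
  · right
    norm_num at h1 h2 hxy
    have hxx : x ^ 2 = 3 * x + 6 := by linear_combination x * h1 - hxy
    have hyy : y ^ 2 = 3 * y + 6 := by linear_combination y * h1 - hxy
    refine ⟨hasTraces_of_sum_eq h hS ?_ ?_ ?_, forall_of_free
      (P := fun t => t ^ 2 = 3 * t + 6) fun k hk => ?_⟩
    · rw [hs, hx, hy]; push_cast
      linear_combination (x + 9) * hxx + (y + 9) * hyy + 17 * h1
    · rw [hs, hx, hy]; push_cast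
      linear_combination (x ^ 2 + 9 * x + 17) * hxx + (y ^ 2 + 9 * y + 17) * hyy + 105 * h1
    · rw [hs, hx, hy]; push_cast
      linear_combination (x ^ 3 + 9 * x ^ 2 + 17 * x + 105) * hxx
        + (y ^ 3 + 9 * y ^ 2 + 17 * y + 105) * hyy + 417 * h1
    · rcases hm k hk with rfl | rfl
      · rw [hx, hxx]
      · rw [hy, hyy]

end Classification

/-- Power sums of three numbers in terms of their elementary symmetric functions. -/
def powerSumThree (a b c : ℤ) : ℕ → ℤ
  | 0 => 3
  | 1 => a
  | 2 => a * a - 2 * b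
  | n + 3 => a * powerSumThree a b c (n + 2) - b * powerSumThree a b c (n + 1)
      + c * powerSumThree a b c n

theorem powerSumThree_eq {a b c : ℤ} {x y z : ℝ} (ha : x + y + z = a)
    (hb : x * y + y * z + z * x = b) (hc : x * y * z = c) :
    ∀ n, x ^ n + y ^ n + z ^ n = powerSumThree a b c n
  | 0 => by norm_num [powerSumThree]
  | 1 => by simp [powerSumThree, ha]
  | 2 => by simp only [powerSumThree]; push_cast; rw [← ha, ← hb]; ring
  | n + 3 => by
    simp only [powerSumThree]
    push_cast
    rw [← powerSumThree_eq ha hb hc n, ← powerSumThree_eq ha hb hc (n + 1),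
      ← powerSumThree_eq ha hb hc (n + 2), ← ha, ← hb, ← hc]
    ring

/-- Power sums of four numbers in terms of their elementary symmetric functions. -/
def powerSumFour (a b c d : ℤ) : ℕ → ℤ
  | 0 => 4
  | 1 => a
  | 2 => a * a - 2 * b
  | 3 => a * (a * a - 2 * b) - b * a + 3 * c
  | n + 4 => a * powerSumFour a b c d (n + 3) - b * powerSumFour a b c d (n + 2)
      + c * powerSumFour a b c d (n + 1) - d * powerSumFour a b c d n

theorem powerSumFour_eq {a b c d : ℤ} {x y z w : ℝ} (ha : x + y + z + w = a)
    (hb : x * y + x * z + x * w + y * z + y * w + z * w = b)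
    (hc : x * y * z + x * y * w + x * z * w + y * z * w = c) (hd : x * y * z * w = d) :
    ∀ n, x ^ n + y ^ n + z ^ n + w ^ n = powerSumFour a b c d n
  | 0 => by norm_num [powerSumFour]
  | 1 => by simp [powerSumFour, ha]
  | 2 => by simp only [powerSumFour]; push_cast; rw [← ha, ← hb]; ring
  | 3 => by simp only [powerSumFour]; push_cast; rw [← ha, ← hb, ← hc]; ring
  | n + 4 => by
    simp only [powerSumFour]
    push_cast
    rw [← powerSumFour_eq ha hb hc hd n, ← powerSumFour_eq ha hb hc hd (n + 1),
      ← powerSumFour_eq ha hb hc hd (n + 2), ← powerSumFour_eq ha hb hc hd (n + 3), ← ha, ← hb,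
      ← hc, ← hd]
    ring

theorem cubic_parameters :
    ∀ e ∈ Finset.Icc (-2 : ℤ) 4, ∀ m ∈ Finset.Icc (-8 : ℤ) 8,
      let a := 2 * e + 1
      let b := 2 * (e * e - 4)
      let c := -4 * m
      let q := (e - 3) * (e + 1) + m
      let s := powerSumThree a b c
      m ≠ 0 → q ≠ 0 → m * q ≤ 8 → -8 ≤ m * q →
      0 ≤ a * a * b * b - 4 * b * b * b - 4 * a * a * a * c + 18 * a * b * c - 27 * c * c →
      (s 6 + 12 * s 5 + 4 * s 4 - 192 * s 3 + 256 * s 2 - 2 * (s 3 + 6 * s 2 - 16 * s 1) - 3) % 32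
        = 0 →
      (e, m) ∈ [((-2 : ℤ), (-1 : ℤ)), (-1, -2), (0, -1), (0, 1), (0, 2), (1, 2), (2, 1), (2, 2),
        (2, 4), (3, 2), (4, -4)] := by
  decide +kernel

theorem quartic_parameters :
    ∀ e ∈ Finset.Icc (-2 : ℤ) 4, ∀ n ∈ Finset.Icc (-3 : ℤ) 3, ∀ q ∈ Finset.Icc (-3 : ℤ) 3,
      let a := 2 * e + 1
      let b := 2 * (e * e - 4)
      let c := 4 * ((e - 3) * (e + 1) + n - q)
      let d := 8 * n
      let s := powerSumFour a b c d
      n ≠ 0 → q ≠ 0 → n * q ≤ 3 → -3 ≤ n * q →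
      (s 6 + 12 * s 5 + 4 * s 4 - 192 * s 3 + 256 * s 2 - 2 * (s 3 + 6 * s 2 - 16 * s 1) - 3) % 32
        = 0 →
      256 * d * d * d - 192 * a * c * d * d - 128 * b * b * d * d + 144 * b * c * c * d
        - 27 * c * c * c * c + 144 * a * a * b * d * d - 6 * a * a * c * c * d
        - 80 * a * b * b * c * d + 18 * a * b * c * c * c + 16 * b * b * b * b * d
        - 4 * b * b * b * c * c - 27 * a * a * a * a * d * d + 18 * a * a * a * b * c * d
        - 4 * a * a * a * c * c * c - 4 * a * a * b * b * b * d + a * a * b * b * c * c < 0 := by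
  decide +kernel

/-- The parameters of the cubic cases that survive the congruences and the discriminant bound. -/
def cubicData : List (ℤ × ℤ × ℤ × ℤ × ℤ × ℤ) :=
  [(3, 0, -4, 87, -201, 375), (1, -6, -8, 99, -113, 379), (-1, -8, -4, 123, 127, 1011),
    (-1, -8, 4, 99, -49, 843), (-1, -8, 8, 87, -137, 759), (-3, -6, 8, 135, 279, 1719),
    (-5, 0, 4, 183, 823, 4087), (-5, 0, 8, 171, 671, 3299), (-5, 0, 16, 147, 367, 1723),
    (-7, 10, 8, 171, 607, 2355), (-9, 24, -16, 183, 759, 3063), (-3, -2, 4, 135, 215, 1015)]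

theorem mem_cubicData :
    ∀ v ∈ [((-2 : ℤ), (-1 : ℤ)), (-1, -2), (0, -1), (0, 1), (0, 2), (1, 2), (2, 1), (2, 2),
        (2, 4), (3, 2), (4, -4)],
      let s := powerSumThree (2 * v.1 + 1) (2 * (v.1 * v.1 - 4)) (-4 * v.2)
      (-(2 * v.1 + 1), 2 * (v.1 * v.1 - 4), 4 * v.2, s 3 + 6 * s 2 - 16 * s 1,
        s 4 + 6 * s 3 - 16 * s 2, s 5 + 6 * s 4 - 16 * s 3) ∈ cubicData := by
  decide +kernel

theorem exp_three_quarters_lt : Real.exp (3 / 4) < 9 / 4 := by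
  have h1 := Real.exp_one_lt_d9
  have h2 : Real.exp (3 / 4) ^ 4 = Real.exp 1 ^ 3 := by
    rw [← Real.exp_nat_mul, ← Real.exp_nat_mul]; norm_num
  by_contra h
  have h5 : (9 / 4 : ℝ) ^ 4 ≤ Real.exp (3 / 4) ^ 4 :=
    pow_le_pow_left₀ (by norm_num) (not_lt.1 h) 4
  have h6 : Real.exp 1 ^ 3 ≤ (2.7182818286 : ℝ) ^ 3 :=
    pow_le_pow_left₀ (Real.exp_pos 1).le h1.le 3
  rw [h2] at h5
  norm_num at h5 h6
  linarith

theorem abs_le_of_abs_mul_le {p q m : ℤ} (hq : q ≠ 0) (h : |p * q| ≤ m) : -m ≤ p ∧ p ≤ m := by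
  rw [abs_mul] at h
  exact abs_le.1 (le_trans (le_mul_of_one_le_right (abs_nonneg p) (Int.one_le_abs hq)) h)

theorem discr_three_nonneg {a b c : ℤ} {x y z : ℝ} (ha : x + y + z = a)
    (hb : x * y + y * z + z * x = b) (hc : x * y * z = c) :
    0 ≤ a * a * b * b - 4 * b * b * b - 4 * a * a * a * c + 18 * a * b * c - 27 * c * c := by
  rw [← Int.cast_nonneg_iff (R := ℝ)]
  push_cast
  rw [← ha, ← hb, ← hc]
  convert sq_nonneg ((x - y) * (y - z) * (z - x)) using 1
  ring

theorem discr_four_nonneg {a b c d : ℤ} {x y z w : ℝ} (ha : x + y + z + w = a)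
    (hb : x * y + x * z + x * w + y * z + y * w + z * w = b)
    (hc : x * y * z + x * y * w + x * z * w + y * z * w = c) (hd : x * y * z * w = d) :
    0 ≤ 256 * d * d * d - 192 * a * c * d * d - 128 * b * b * d * d + 144 * b * c * c * d
        - 27 * c * c * c * c + 144 * a * a * b * d * d - 6 * a * a * c * c * d
        - 80 * a * b * b * c * d + 18 * a * b * c * c * c + 16 * b * b * b * b * d
        - 4 * b * b * b * c * c - 27 * a * a * a * a * d * d + 18 * a * a * a * b * c * d
        - 4 * a * a * a * c * c * c - 4 * a * a * b * b * b * d + a * a * b * b * c * c := by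
  rw [← Int.cast_nonneg_iff (R := ℝ)]
  push_cast
  rw [← ha, ← hb, ← hc, ← hd]
  convert sq_nonneg ((x - y) * (x - z) * (x - w) * (y - z) * (y - w) * (z - w)) using 1
  ring

section Classification

variable {N A : Matrix (Fin 21) (Fin 21) ℤ} {b : Fin 21 → ℤ} {ev : Fin 21 → ℝ}
  {U : Fin 21 → Fin 21 → ℝ}

theorem classify_three (hN : IsEvenLineMatrix N A b) (h : IsSpectralFrame N ev U)
    (hS : IsLineSpectrum ev) {e p q : ℤ} (he : e ≤ 4) (hp0 : p ≠ 0) (hq0 : q ≠ 0)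
    (h1 : ∑ i ∈ freeIndices ev, ev i = 2 * e + 1)
    (h2 : ∑ i ∈ freeIndices ev, ev i ^ 2 = 17 + 4 * e)
    (hp : (p : ℝ) = 2 * ∏ k ∈ freeIndices ev, (-ev k / 2))
    (hq : (q : ℝ) = 2 * ∏ k ∈ freeIndices ev, (1 - ev k / 2))
    (hr : (freeIndices ev).card = 3) :
    ∃ a b d t₀ t₁ t₂, (a, b, d, t₀, t₁, t₂) ∈ cubicData ∧ CubicCase N ev a b d t₀ t₁ t₂ := by
  have hpq : |p * q| ≤ 8 := by
    have h3 := (free_prod_bound hp0 hq0 h1 h2 hp hq).2.2.2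
    rw [hr] at h3
    norm_num at h3
    have h4 : (|p * q| : ℝ) < (9 : ℤ) := by
      rw [abs_mul]; push_cast; linarith [exp_three_quarters_lt]
    have h5 : |p * q| < 9 := by exact_mod_cast h4
    omega
  obtain ⟨i, j, k, hm, hs, hprod⟩ := exists_three_of_card hr
  rw [hs] at h1 h2
  rw [hprod] at hp hq
  generalize hx : ev i = x at *
  generalize hy : ev j = y at *
  generalize hz : ev k = z at *
  have hE1 : x + y + z = ((2 * e + 1 : ℤ) : ℝ) := by push_cast; exact h1
  have hE2 : x * y + y * z + z * x = ((2 * (e * e - 4) : ℤ) : ℝ) := by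
    push_cast
    linear_combination (1 / 2) * (x + y + z + 2 * e + 1) * h1 - (1 / 2) * h2
  have hE3 : x * y * z = ((-4 * p : ℤ) : ℝ) := by
    push_cast; linear_combination 4 * hp
  have hq' : q = (e - 3) * (e + 1) + p := by
    have : (q : ℝ) = (((e - 3) * (e + 1) + p : ℤ) : ℝ) := by
      push_cast at hE1 hE2 hE3 ⊢
      linear_combination hq - hE1 + (1 / 2) * hE2 - (1 / 4) * hE3
    exact_mod_cast this
  have he' : -2 ≤ e := by
    have h3 : (4 * e ^ 2 - 8 * e - 50 : ℝ) ≤ 0 := by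
      nlinarith [sq_nonneg (x - y), sq_nonneg (y - z), sq_nonneg (z - x)]
    have h4 : 4 * e ^ 2 - 8 * e - 50 ≤ 0 := by exact_mod_cast h3
    nlinarith
  have hps := powerSumThree_eq hE1 hE2 hE3
  have htr : ∀ n, x ^ n * (x * (x - 2) * (x + 8)) + y ^ n * (y * (y - 2) * (y + 8))
      + z ^ n * (z * (z - 2) * (z + 8))
      = ((powerSumThree (2 * e + 1) (2 * (e * e - 4)) (-4 * p) (n + 3)
        + 6 * powerSumThree (2 * e + 1) (2 * (e * e - 4)) (-4 * p) (n + 2)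
        - 16 * powerSumThree (2 * e + 1) (2 * (e * e - 4)) (-4 * p) (n + 1) : ℤ) : ℝ) := by
    intro n
    push_cast [← hps]
    ring
  have hmod := hN.dvd_of_sum_eq h hS
    (t := powerSumThree (2 * e + 1) (2 * (e * e - 4)) (-4 * p) 3
      + 6 * powerSumThree (2 * e + 1) (2 * (e * e - 4)) (-4 * p) 2
      - 16 * powerSumThree (2 * e + 1) (2 * (e * e - 4)) (-4 * p) 1)
    (s := powerSumThree (2 * e + 1) (2 * (e * e - 4)) (-4 * p) 6
      + 12 * powerSumThree (2 * e + 1) (2 * (e * e - 4)) (-4 * p) 5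
      + 4 * powerSumThree (2 * e + 1) (2 * (e * e - 4)) (-4 * p) 4
      - 192 * powerSumThree (2 * e + 1) (2 * (e * e - 4)) (-4 * p) 3
      + 256 * powerSumThree (2 * e + 1) (2 * (e * e - 4)) (-4 * p) 2)
    (by rw [hs, hx, hy, hz]; linear_combination htr 0)
    (by rw [hs, hx, hy, hz]; push_cast [← hps]; ring)
  have hdisc := discr_three_nonneg hE1 hE2 hE3
  obtain ⟨hp1, hp2⟩ := abs_le_of_abs_mul_le hq0 hpq
  obtain ⟨hpq1, hpq2⟩ := abs_le.1 hpq
  have hmem := cubic_parameters e (Finset.mem_Icc.2 ⟨he', he⟩) p (Finset.mem_Icc.2 ⟨hp1, hp2⟩)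
    hp0 (hq' ▸ hq0) (hq' ▸ hpq2) (hq' ▸ hpq1) hdisc (Int.emod_eq_zero_of_dvd hmod)
  refine ⟨_, _, _, _, _, _, mem_cubicData _ hmem, ⟨hasTraces_of_sum_eq h hS ?_ ?_ ?_, ?_⟩⟩
  · rw [hs, hx, hy, hz]; linear_combination htr 0
  · rw [hs, hx, hy, hz]; linear_combination htr 1
  · rw [hs, hx, hy, hz]; linear_combination htr 2
  · refine forall_of_free (P := fun t => t ^ 3 + ((-(2 * e + 1) : ℤ) : ℝ) * t ^ 2
      + ((2 * (e * e - 4) : ℤ) : ℝ) * t + ((4 * p : ℤ) : ℝ) = 0) fun l hl => ?_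
    push_cast at hE1 hE2 hE3 ⊢
    rcases hm l hl with rfl | rfl | rfl
    · rw [hx]; linear_combination x ^ 2 * hE1 - x * hE2 + hE3
    · rw [hy]; linear_combination y ^ 2 * hE1 - y * hE2 + hE3
    · rw [hz]; linear_combination z ^ 2 * hE1 - z * hE2 + hE3

theorem card_free_ne_four (hN : IsEvenLineMatrix N A b) (h : IsSpectralFrame N ev U)
    (hS : IsLineSpectrum ev) {e p q : ℤ} (he : e ≤ 4) (hp0 : p ≠ 0) (hq0 : q ≠ 0)
    (h1 : ∑ i ∈ freeIndices ev, ev i = 2 * e + 1)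
    (h2 : ∑ i ∈ freeIndices ev, ev i ^ 2 = 17 + 4 * e)
    (hp : (p : ℝ) = 2 * ∏ k ∈ freeIndices ev, (-ev k / 2))
    (hq : (q : ℝ) = 2 * ∏ k ∈ freeIndices ev, (1 - ev k / 2)) :
    (freeIndices ev).card ≠ 4 := by
  intro hr
  have hpq : |p * q| ≤ 3 := by
    have h3 := (free_prod_bound hp0 hq0 h1 h2 hp hq).2.2.2
    rw [hr] at h3
    have h6 : Real.exp (15 / 4 - (4 : ℕ)) < 1 := by
      rw [← Real.exp_zero]; exact Real.exp_lt_exp.2 (by norm_num)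
    have h4 : (|p * q| : ℝ) < (4 : ℤ) := by push_cast; linarith
    have h5 : |p * q| < 4 := by exact_mod_cast h4
    omega
  obtain ⟨i, j, k, l, -, hs, hprod⟩ := exists_four_of_card hr
  rw [hs] at h1 h2
  rw [hprod] at hp hq
  generalize hx : ev i = x at *
  generalize hy : ev j = y at *
  generalize hz : ev k = z at *
  generalize hw : ev l = w at *
  have hE1 : x + y + z + w = ((2 * e + 1 : ℤ) : ℝ) := by push_cast; exact h1
  have hE2 : x * y + x * z + x * w + y * z + y * w + z * w = ((2 * (e * e - 4) : ℤ) : ℝ) := by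
    push_cast
    linear_combination (1 / 2) * (x + y + z + w + 2 * e + 1) * h1 - (1 / 2) * h2
  have hE4 : x * y * z * w = ((8 * p : ℤ) : ℝ) := by
    push_cast; linear_combination -8 * hp
  have hE3 : x * y * z + x * y * w + x * z * w + y * z * w
      = ((4 * ((e - 3) * (e + 1) + p - q) : ℤ) : ℝ) := by
    push_cast at hE1 hE2 hE4 ⊢
    linear_combination 4 * hq - 4 * hE1 + 2 * hE2 + (1 / 2) * hE4
  have he' : -2 ≤ e := by
    have h3 : (4 * e ^ 2 - 12 * e - 67 : ℝ) ≤ 0 := by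
      nlinarith [sq_nonneg (x - y), sq_nonneg (y - z), sq_nonneg (z - x), sq_nonneg (x - w),
        sq_nonneg (y - w), sq_nonneg (z - w)]
    have h4 : 4 * e ^ 2 - 12 * e - 67 ≤ 0 := by exact_mod_cast h3
    nlinarith
  have hps := powerSumFour_eq hE1 hE2 hE3 hE4
  set s := powerSumFour (2 * e + 1) (2 * (e * e - 4)) (4 * ((e - 3) * (e + 1) + p - q)) (8 * p)
    with hsdef
  have hmod := hN.dvd_of_sum_eq h hS (t := s 3 + 6 * s 2 - 16 * s 1)
    (s := s 6 + 12 * s 5 + 4 * s 4 - 192 * s 3 + 256 * s 2)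
    (by rw [hs, hx, hy, hz, hw]; push_cast [← hps]; ring)
    (by rw [hs, hx, hy, hz, hw]; push_cast [← hps]; ring)
  have hdisc := discr_four_nonneg hE1 hE2 hE3 hE4
  obtain ⟨hp1, hp2⟩ := abs_le_of_abs_mul_le hq0 hpq
  obtain ⟨hq1, hq2⟩ := abs_le_of_abs_mul_le hp0 (mul_comm p q ▸ hpq)
  obtain ⟨hpq1, hpq2⟩ := abs_le.1 hpq
  exact absurd hdisc (not_le.2 (quartic_parameters e (Finset.mem_Icc.2 ⟨he', he⟩) p
    (Finset.mem_Icc.2 ⟨hp1, hp2⟩) q (Finset.mem_Icc.2 ⟨hq1, hq2⟩) hp0 hq0 hpq2 hpq1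
    (Int.emod_eq_zero_of_dvd hmod)))

end Classification

section Classification

variable {N A : Matrix (Fin 21) (Fin 21) ℤ} {b : Fin 21 → ℤ} {ev : Fin 21 → ℝ}
  {U : Fin 21 → Fin 21 → ℝ}

theorem eq_zero_of_sum_four_sqrt_five {m : ℤ} (hm : -10 ≤ m) (hm' : m ≤ 2) {x y z w : ℝ}
    (hx : x ^ 2 = 5) (hy : y ^ 2 = 5) (hz : z ^ 2 = 5) (hw : w ^ 2 = 5)
    (h : x + y + z + w = 2 * m) : m = 0 := by
  have key : ∀ k : ℤ, k * x = 2 * m → 5 * k ^ 2 = 4 * m ^ 2 := fun k hk => by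
    have : (5 * k ^ 2 : ℝ) = 4 * m ^ 2 := by
      linear_combination (k * x + 2 * m) * hk - k ^ 2 * hx
    exact_mod_cast this
  have no : ¬ (5 * 4 ^ 2 = 4 * m ^ 2) ∧ ¬ (5 * 2 ^ 2 = 4 * m ^ 2) := by
    constructor <;> intro h <;> interval_cases m <;> omega
  have zero : 5 * 0 ^ 2 = 4 * m ^ 2 → m = 0 := fun h => by
    have : m ^ 2 = 0 := by linarith
    exact pow_eq_zero_iff (two_ne_zero) |>.1 this
  rcases sq_eq_sq_iff_eq_or_eq_neg.1 (hy.trans hx.symm) with rfl | rfl <;>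
  rcases sq_eq_sq_iff_eq_or_eq_neg.1 (hz.trans hx.symm) with rfl | rfl <;>
  rcases sq_eq_sq_iff_eq_or_eq_neg.1 (hw.trans hx.symm) with rfl | rfl <;>
  first
  | exact zero (key 0 (by push_cast; linarith))
  | exact absurd (key 4 (by push_cast; linarith)) no.1
  | exact absurd (key 2 (by push_cast; linarith)) no.2
  | exact absurd (by linarith [key (-2) (by push_cast; linarith)]) no.2

theorem classify_five (h : IsSpectralFrame N ev U)
    (hS : IsLineSpectrum ev) {e p q : ℤ} (he : e ≤ 4) (he' : -8 ≤ e) (hp0 : p ≠ 0) (hq0 : q ≠ 0)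
    (h1 : ∑ i ∈ freeIndices ev, ev i = 2 * e + 1)
    (h2 : ∑ i ∈ freeIndices ev, ev i ^ 2 = 17 + 4 * e)
    (hp : (p : ℝ) = 2 * ∏ k ∈ freeIndices ev, (-ev k / 2))
    (hq : (q : ℝ) = 2 * ∏ k ∈ freeIndices ev, (1 - ev k / 2))
    (hr : (freeIndices ev).card = 5) : CubicCase N ev (-3) (-2) 4 135 215 1015 := by
  obtain ⟨hb1, hb2, hb3, -⟩ := free_prod_bound hp0 hq0 h1 h2 hp hq
  push_cast at hb2
  obtain ⟨c, hc, hc1, hrest⟩ := exists_eq_neg_quarter_of_prod (freeIndices ev)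
    (fun k => ev k * (ev k - 2) / 4) hr (fun k _ => by nlinarith [sq_nonneg (ev k - 1)])
    (fun k hk => by
      obtain ⟨-, h0, h2⟩ := (Finset.mem_filter.1 hk).2
      exact div_ne_zero (mul_ne_zero h0 (sub_ne_zero.2 h2)) (by norm_num)) hb1 (by linarith)
  have hcv : ev c = 1 := by
    have : (ev c - 1) ^ 2 = 0 := by linarith
    linarith [pow_eq_zero_iff (two_ne_zero) |>.1 this]
  have hsq : ∀ k ∈ (freeIndices ev).erase c, ev k ^ 2 = 2 * ev k + 4 := fun k hk => by
    linarith [hrest k hk]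
  have hcard : ((freeIndices ev).erase c).card = 4 := by
    rw [Finset.card_erase_of_mem hc, hr]
  obtain ⟨i, j, k, l, hm, hs, -⟩ := exists_four_of_card hcard
  have hall : ∀ g : Fin 21 → ℝ, ∑ t ∈ freeIndices ev, g t = g c + (g i + g j + g k + g l) :=
    fun g => by rw [← hs, Finset.add_sum_erase _ _ hc]
  obtain ⟨hxx, hyy, hzz, hww⟩ :
      ev i ^ 2 = 2 * ev i + 4 ∧ ev j ^ 2 = 2 * ev j + 4 ∧ ev k ^ 2 = 2 * ev k + 4 ∧
        ev l ^ 2 = 2 * ev l + 4 := by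
    have h0 := hs fun t => (ev t ^ 2 - (2 * ev t + 4)) ^ 2
    rw [Finset.sum_eq_zero fun t ht => by rw [hsq t ht]; ring] at h0
    have hz : ∀ t, (ev t ^ 2 - (2 * ev t + 4)) ^ 2 = 0 → ev t ^ 2 = 2 * ev t + 4 := fun t ht =>
      sub_eq_zero.1 (pow_eq_zero_iff two_ne_zero |>.1 ht)
    have hpos := fun t => sq_nonneg (ev t ^ 2 - (2 * ev t + 4))
    exact ⟨hz i (by linarith [hpos i, hpos j, hpos k, hpos l]),
      hz j (by linarith [hpos i, hpos j, hpos k, hpos l]),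
      hz k (by linarith [hpos i, hpos j, hpos k, hpos l]),
      hz l (by linarith [hpos i, hpos j, hpos k, hpos l])⟩
  rw [hall, hcv] at h1
  have he2 : e - 2 = 0 := eq_zero_of_sum_four_sqrt_five (by omega) (by omega)
    (x := ev i - 1) (y := ev j - 1) (z := ev k - 1) (w := ev l - 1)
    (by linarith) (by linarith) (by linarith) (by linarith) (by push_cast; linarith)
  obtain rfl : e = 2 := by omega
  push_cast at h1
  refine ⟨hasTraces_of_sum_eq h hS ?_ ?_ ?_, forall_of_free (P := fun t => t ^ 3 +
    ((-3 : ℤ) : ℝ) * t ^ 2 + ((-2 : ℤ) : ℝ) * t + ((4 : ℤ) : ℝ) = 0) fun t ht => ?_⟩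
  · rw [hall, hcv]; push_cast
    linear_combination (ev i + 8) * hxx + (ev j + 8) * hyy + (ev k + 8) * hzz + (ev l + 8) * hww
      + 4 * h1
  · rw [hall, hcv]; push_cast
    linear_combination (ev i ^ 2 + 8 * ev i + 4) * hxx + (ev j ^ 2 + 8 * ev j + 4) * hyy
      + (ev k ^ 2 + 8 * ev k + 4) * hzz + (ev l ^ 2 + 8 * ev l + 4) * hww + 40 * h1
  · rw [hall, hcv]; push_cast
    linear_combination (ev i ^ 3 + 8 * ev i ^ 2 + 4 * ev i + 40) * hxx
      + (ev j ^ 3 + 8 * ev j ^ 2 + 4 * ev j + 40) * hyy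
      + (ev k ^ 3 + 8 * ev k ^ 2 + 4 * ev k + 40) * hzz
      + (ev l ^ 3 + 8 * ev l ^ 2 + 4 * ev l + 40) * hww + 96 * h1
  · push_cast
    by_cases htc : t = c
    · rw [htc, hcv]; norm_num
    · linear_combination (ev t - 1) * hsq t (Finset.mem_erase.2 ⟨htc, ht⟩)

/-- The possible spectra of a line matrix. -/
theorem spectrum_cases (hN : IsEvenLineMatrix N A b) (h : IsSpectralFrame N ev U)
    (hS : IsLineSpectrum ev) :
    (HasTraces N 195 975 4875 ∧ ∀ k, ev k = -8 ∨ ev k = 0 ∨ ev k = 2 ∨ ev k = 5) ∨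
    (HasTraces N 75 (-225) 675 ∧ ∀ k, ev k = -8 ∨ ev k = 0 ∨ ev k = 2 ∨ ev k = -3) ∨
    (HasTraces N 111 39 927 ∧
      ∀ k, ev k = -8 ∨ ev k = 0 ∨ ev k = 2 ∨ ev k ^ 2 = ev k + 8) ∨
    (HasTraces N 159 519 2511 ∧
      ∀ k, ev k = -8 ∨ ev k = 0 ∨ ev k = 2 ∨ ev k ^ 2 = 3 * ev k + 6) ∨
    ∃ a b d t₀ t₁ t₂, (a, b, d, t₀, t₁, t₂) ∈ cubicData ∧ CubicCase N ev a b d t₀ t₁ t₂ := by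
  obtain ⟨e, p, q, he, he', hp0, hq0, h1, h2, hp, hq⟩ := exists_free_data hN h hS
  have hlt : (freeIndices ev).card < 6 := by
    by_contra hge
    obtain ⟨-, hb2, -, hb4⟩ := free_prod_bound hp0 hq0 h1 h2 hp hq
    push_cast at hb2
    have h3 : (6 : ℝ) ≤ (freeIndices ev).card := by exact_mod_cast not_lt.1 hge
    have h4 : Real.exp (15 / 4 - (freeIndices ev).card) ≤ Real.exp (-(9 / 4)) :=
      Real.exp_le_exp.2 (by linarith)
    have h5 := Real.quadratic_le_exp_of_nonneg (x := 9 / 4) (by norm_num)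
    have h6 : Real.exp (-(9 / 4)) * Real.exp (9 / 4) = 1 := by rw [← Real.exp_add]; norm_num
    nlinarith [Real.exp_pos (-(9 / 4))]
  interval_cases hr : (freeIndices ev).card
  · rw [Finset.card_eq_zero.1 hr, Finset.sum_empty] at h1
    have h3 : (0 : ℤ) = 2 * e + 1 := by exact_mod_cast h1
    omega
  · have := classify_one h hS h1 h2 hr
    tauto
  · have := classify_two h hS h1 h2 hr
    tauto
  · exact Or.inr (Or.inr (Or.inr (Or.inr
      (classify_three hN h hS he hp0 hq0 h1 h2 hp hq hr))))
  · exact absurd hr (card_free_ne_four hN h hS he hp0 hq0 h1 h2 hp hq)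
  · exact Or.inr (Or.inr (Or.inr (Or.inr ⟨_, _, _, _, _, _, by decide,
      classify_five h hS he he' hp0 hq0 h1 h2 hp hq hr⟩)))

end Classification

section VertexInequalities

variable {N A : Matrix (Fin 21) (Fin 21) ℤ} {β : Fin 21 → ℤ} {ev : Fin 21 → ℝ}
  {U : Fin 21 → Fin 21 → ℝ} {a b d t₀ t₁ t₂ : ℤ}

open Polynomial in
/-- A quintic that is nonnegative on the spectrum has nonnegative diagonal entries. -/
theorem IsSpectralFrame.diag_form_nonneg (hN : IsEvenLineMatrix N A β) (h : IsSpectralFrame N ev U)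
    {c₀ c₁ c₂ d₀ d₁ d₂ : ℤ}
    (hpos : ∀ k, 0 ≤ ev k * (ev k - 2) * (ev k + 8) * (c₀ + c₁ * ev k + c₂ * ev k ^ 2)
      + (d₀ + d₁ * ev k + d₂ * ev k ^ 2)) (i : Fin 21) :
    0 ≤ c₀ * residualMatrix N i i + c₁ * (N * residualMatrix N) i i
      + c₂ * (N * (N * residualMatrix N)) i i + (d₀ - 3 * d₁ + 29 * d₂) := by
  have h1 := h.diag_nonneg (p := c₀ • residualPoly + c₁ • (X * residualPoly)
    + c₂ • (X * (X * residualPoly)) + (d₀ • 1 + d₁ • X + d₂ • X ^ 2)) (fun k => by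
      simp only [map_add, map_smul, map_mul, map_pow, map_one, aeval_X, aeval_real_residualPoly]
      simp only [zsmul_eq_mul]
      convert hpos k using 1
      ring) i
  have h2 : N i i = -3 := by rw [hN.eq_add, hN.diag]; norm_num
  simp only [map_add, map_smul, map_mul, map_pow, map_one, aeval_X, aeval_residualPoly,
    Matrix.add_apply, Matrix.smul_apply, smul_eq_mul, hN.sq_diag, Matrix.one_apply_eq, h2] at h1
  linarith

namespace CubicCase

theorem diag_nonneg_of_root (hC : CubicCase N ev a b d t₀ t₁ t₂) (hN : IsEvenLineMatrix N A β)
    (h : IsSpectralFrame N ev U) (hS : IsLineSpectrum ev) {c₀ c₁ c₂ : ℤ}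
    (hpos : ∀ t : ℝ, -8 ≤ t → t ^ 3 + a * t ^ 2 + b * t + d = 0 →
      0 ≤ t * (t - 2) * (t + 8) * (c₀ + c₁ * t + c₂ * t ^ 2)) (i : Fin 21) :
    0 ≤ c₀ * residualMatrix N i i + c₁ * (N * residualMatrix N) i i
      + c₂ * (N * (N * residualMatrix N)) i i := by
  have := h.diag_form_nonneg hN (c₀ := c₀) (c₁ := c₁) (c₂ := c₂) (d₀ := 0) (d₁ := 0) (d₂ := 0)
    (fun k => by
      rcases hC.root k with hk | hk | hk | hk
      · rw [hk]; norm_num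
      · rw [hk]; norm_num
      · rw [hk]; norm_num
      · simpa using hpos _ (hS.neg_eight_le k) hk) i
  simpa using this

/-- The inequality obtained from `X² (X - 2)² (X + 8) g²`, reduced modulo the cubic. -/
theorem square_nonneg (hC : CubicCase N ev a b d t₀ t₁ t₂) (hN : IsEvenLineMatrix N A β)
    (h : IsSpectralFrame N ev U) (hS : IsLineSpectrum ev) (c₀ c₁ c₂ : ℤ) (g q : ℝ → ℝ)
    (hg : ∀ t, t * (t - 2) * g t ^ 2
      = q t * (t ^ 3 + a * t ^ 2 + b * t + d) + (c₀ + c₁ * t + c₂ * t ^ 2)) (i : Fin 21) :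
    0 ≤ c₀ * residualMatrix N i i + c₁ * (N * residualMatrix N) i i
      + c₂ * (N * (N * residualMatrix N)) i i := by
  refine hC.diag_nonneg_of_root hN h hS (fun t ht hf => ?_) i
  have e : t * (t - 2) * (t + 8) * (c₀ + c₁ * t + c₂ * t ^ 2)
      = (t + 8) * (t * (t - 2) * g t) ^ 2 := by
    have := hg t
    rw [hf] at this
    linear_combination -t * (t - 2) * (t + 8) * this
  rw [e]
  exact mul_nonneg (by linarith) (sq_nonneg _)

theorem zero_nonneg (hC : CubicCase N ev a b d t₀ t₁ t₂) (hN : IsEvenLineMatrix N A β)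
    (h : IsSpectralFrame N ev U) (i : Fin 21) :
    0 ≤ -d * b * residualMatrix N i i + -d * a * (N * residualMatrix N) i i
      + -d * (N * (N * residualMatrix N)) i i + 5 * d * d := by
  have := h.diag_form_nonneg hN (c₀ := -d * b) (c₁ := -d * a) (c₂ := -d) (d₀ := 16 * d * d)
    (d₁ := -6 * d * d) (d₂ := -d * d) (fun k => by
      push_cast
      rcases hC.root k with hk | hk | hk | hk
      · rw [hk]; linarith
      · rw [hk]; nlinarith [sq_nonneg (d : ℝ)]
      · rw [hk]; linarith
      · refine le_of_eq ?_
        linear_combination d * (ev k - 2) * (ev k + 8) * hk) i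
  linarith

theorem two_nonneg (hC : CubicCase N ev a b d t₀ t₁ t₂) (hN : IsEvenLineMatrix N A β)
    (h : IsSpectralFrame N ev U) (i : Fin 21) :
    let f := 8 + 4 * a + 2 * b + d
    0 ≤ f * (b + 4 + 2 * a) * residualMatrix N i i + f * (2 + a) * (N * residualMatrix N) i i
      + f * (N * (N * residualMatrix N)) i i + 5 * f * f := by
  intro f
  have hf : (f : ℝ) = 8 + 4 * a + 2 * b + d := by simp [f]
  have := h.diag_form_nonneg hN (c₀ := f * (b + 4 + 2 * a)) (c₁ := f * (2 + a)) (c₂ := f)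
    (d₀ := 0) (d₁ := 8 * f * f) (d₂ := f * f) (fun k => by
      push_cast
      rcases hC.root k with hk | hk | hk | hk
      · rw [hk]; linarith
      · rw [hk]; linarith
      · rw [hk]; nlinarith [sq_nonneg (f : ℝ)]
      · refine le_of_eq ?_
        linear_combination -f * ev k * (ev k + 8) * hk - f * ev k * (ev k + 8) * hf) i
  linarith

end CubicCase

theorem HasTraces.sum_le (hT : HasTraces N t₀ t₁ t₂) {c₀ c₁ c₂ m : ℤ}
    (hle : ∀ i, c₀ * residualMatrix N i i + c₁ * (N * residualMatrix N) i i
      + c₂ * (N * (N * residualMatrix N)) i i ≤ m) :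
    c₀ * t₀ + c₁ * t₁ + c₂ * t₂ ≤ 21 * m := by
  rw [← hT.zero, ← hT.one, ← hT.two]
  have := Finset.sum_le_card_nsmul Finset.univ _ m fun i _ => hle i
  simp only [Finset.sum_add_distrib, ← Finset.mul_sum, Finset.card_univ, Fintype.card_fin,
    nsmul_eq_mul] at this
  exact_mod_cast this

theorem HasTraces.congr_of_mod_eq_three (hT : HasTraces N t₀ t₁ t₂) (hN : IsEvenLineMatrix N A β)
    (ht : t₀ % 8 = 3) (i : Fin 21) :
    8 ∣ residualMatrix N i i - 7 ∧ 8 ∣ (N * residualMatrix N) i i - 5 * residualMatrix N i i ∧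
    16 ∣ (N * (N * residualMatrix N)) i i - 5 * (N * residualMatrix N) i i - (t₂ - 5 * t₁) := by
  rw [← hT.zero] at ht
  rw [← hT.one, ← hT.two]
  exact hN.congr_of_trace_mod_eq_three ht i

theorem HasTraces.congr_of_mod_eq_seven (hT : HasTraces N t₀ t₁ t₂) (hN : IsEvenLineMatrix N A β)
    (ht : t₀ % 8 = 7) (i : Fin 21) :
    8 ∣ residualMatrix N i i - 3 ∧
    16 ∣ (N * residualMatrix N) i i - residualMatrix N i i - (t₁ - t₀) ∧
    16 ∣ (N * (N * residualMatrix N)) i i - (N * residualMatrix N) i i - (t₂ - t₁) := by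
  rw [← hT.zero] at ht
  obtain ⟨V, hV, h3, hV1, hV2⟩ := hN.congr_of_trace_mod_eq_seven ht
  have e : N * residualMatrix N = residualMatrix N + (8 : ℤ) • V := by
    ext i j; rw [hV, Matrix.add_apply, Matrix.smul_apply, smul_eq_mul]
  have e' : N * (N * residualMatrix N) = N * residualMatrix N + (8 : ℤ) • (N * V) := by
    conv_lhs => rw [e, mul_add, Matrix.mul_smul]
  have hi' : (N * (N * residualMatrix N)) i i = (N * residualMatrix N) i i + 8 * (N * V) i i := by
    rw [e', Matrix.add_apply, Matrix.smul_apply, smul_eq_mul]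
  have ht1 : t₁ = t₀ + 8 * V.trace := by
    rw [← hT.one, ← hT.zero, e, Matrix.trace_add, Matrix.trace_smul, smul_eq_mul]
  have ht2 : t₂ = t₁ + 8 * (N * V).trace := by
    rw [← hT.two, ← hT.one, e', Matrix.trace_add, Matrix.trace_smul, smul_eq_mul]
  have hi := hV i i
  have := h3 i
  have := hV1 i
  have := hV2 i
  refine ⟨h3 i, ?_, ?_⟩ <;> omega

end VertexInequalities

section CubicCases

variable {N A : Matrix (Fin 21) (Fin 21) ℤ} {β : Fin 21 → ℤ} {ev : Fin 21 → ℝ}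
  {U : Fin 21 → Fin 21 → ℝ}

theorem CubicCase.false_of_three_zero_neg_four
    (hC : CubicCase N ev 3 0 (-4) 87 (-201) 375) (hN : IsEvenLineMatrix N A β)
    (h : IsSpectralFrame N ev U) (hS : IsLineSpectrum ev) : False := by
  have hle := hC.sum_le (c₀ := 1) (c₁ := 0) (c₂ := 0) (m := 3) fun i => by
    have hmod := hC.congr_of_mod_eq_seven hN (by norm_num) i
    have hz := hC.zero_nonneg hN h i
    have ht := hC.two_nonneg hN h i
    have hg₁ := hC.square_nonneg hN h hS (-4) (-4) (-1) (fun t => t ^ 2 + 2 * t)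
      (fun t => t ^ 3 - t ^ 2 - t - 1) (fun t => by push_cast; ring) i
    have hr₁ := hC.diag_nonneg_of_root hN h hS (c₀ := -2) (c₁ := 1) (c₂ := 1)
      (fun t _ ht => by
        push_cast at ht ⊢
        have h0 : (t - 1) * (t + 2) = 0 := by
          have : ((t - 1) * (t + 2)) ^ 2 = 0 := by linear_combination (t - 1) * ht
          exact pow_eq_zero_iff two_ne_zero |>.1 this
        refine le_of_eq ?_
        linear_combination -t * (t - 2) * (t + 8) * h0) i
    have hr₂ := hC.diag_nonneg_of_root hN h hS (c₀ := 2) (c₁ := -1) (c₂ := -1)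
      (fun t _ ht => by
        push_cast at ht ⊢
        have h0 : (t - 1) * (t + 2) = 0 := by
          have : ((t - 1) * (t + 2)) ^ 2 = 0 := by linear_combination (t - 1) * ht
          exact pow_eq_zero_iff two_ne_zero |>.1 this
        refine le_of_eq ?_
        linear_combination t * (t - 2) * (t + 8) * h0) i
    omega
  norm_num at hle

theorem CubicCase.false_of_one_neg_six_neg_eight
    (hC : CubicCase N ev 1 (-6) (-8) 99 (-113) 379) (hN : IsEvenLineMatrix N A β)
    (h : IsSpectralFrame N ev U) (hS : IsLineSpectrum ev) : False := by
  have hle := hC.sum_le (c₀ := -1) (c₁ := 0) (c₂ := 0) (m := -7) fun i => by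
    have hmod := hC.congr_of_mod_eq_three hN (by norm_num) i
    have hz := hC.zero_nonneg hN h i
    have ht := hC.two_nonneg hN h i
    have hg₁ := hC.square_nonneg hN h hS 280 (-24) (-32) (fun t => t ^ 2 - 9)
      (fun t => t ^ 3 - 3 * t ^ 2 - 9 * t + 35) (fun t => by push_cast; ring) i
    have hg₂ := hC.square_nonneg hN h hS (-64) 46 57 (fun t => 2 * t ^ 2 + 2 * t - 1)
      (fun t => 4 * t ^ 3 - 4 * t ^ 2 + 12 * t - 8) (fun t => by push_cast; ring) i
    omega
  norm_num at hle

theorem CubicCase.false_of_neg_one_neg_eight_neg_four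
    (hC : CubicCase N ev (-1) (-8) (-4) 123 127 1011) (hN : IsEvenLineMatrix N A β)
    (h : IsSpectralFrame N ev U) (hS : IsLineSpectrum ev) : False := by
  have hle := hC.sum_le (c₀ := -1) (c₁ := 0) (c₂ := 0) (m := -7) fun i => by
    have hmod := hC.congr_of_mod_eq_three hN (by norm_num) i
    have hz := hC.zero_nonneg hN h i
    have ht := hC.two_nonneg hN h i
    have hg₁ := hC.square_nonneg hN h hS 76 116 71 (fun t => t ^ 2 + 2 * t - 4)
      (fun t => t ^ 3 + 3 * t ^ 2 - t + 19) (fun t => by push_cast; ring) i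
    have hg₂ := hC.square_nonneg hN h hS 96 (-2) (-7) (fun t => t ^ 2 - t - 9)
      (fun t => t ^ 3 - 3 * t ^ 2 - 8 * t + 24) (fun t => by push_cast; ring) i
    omega
  norm_num at hle

theorem CubicCase.false_of_neg_one_neg_eight_four
    (hC : CubicCase N ev (-1) (-8) 4 99 (-49) 843) (hN : IsEvenLineMatrix N A β)
    (h : IsSpectralFrame N ev U) (hS : IsLineSpectrum ev) : False := by
  have hle := hC.sum_le (c₀ := 6) (c₁ := 1) (c₂ := -1) (m := -18) fun i => by
    have hmod := hC.congr_of_mod_eq_three hN (by norm_num) i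
    have hz := hC.zero_nonneg hN h i
    have ht := hC.two_nonneg hN h i
    have hg₁ := hC.square_nonneg hN h hS (-36) 2 6 (fun t => t ^ 2 - 7)
      (fun t => t ^ 3 - t ^ 2 - 7 * t + 9) (fun t => by push_cast; ring) i
    have hg₂ := hC.square_nonneg hN h hS (-260) (-30) 38 (fun t => 2 * t ^ 2 - t - 19)
      (fun t => 4 * t ^ 3 - 8 * t ^ 2 - 43 * t + 65) (fun t => by push_cast; ring) i
    have hg₃ := hC.square_nonneg hN h hS (-60) (-28) 15 (fun t => t ^ 2 - 10)
      (fun t => t ^ 3 - t ^ 2 - 13 * t + 15) (fun t => by push_cast; ring) i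
    obtain ⟨r, hr⟩ := hmod.1
    by_contra
    have hr0 : -1 ≤ r := by omega
    have hr1 : r ≤ -1 := by omega
    omega
  norm_num at hle

theorem CubicCase.false_of_neg_one_neg_eight_eight
    (hC : CubicCase N ev (-1) (-8) 8 87 (-137) 759) (hN : IsEvenLineMatrix N A β)
    (h : IsSpectralFrame N ev U) (hS : IsLineSpectrum ev) : False := by
  have hle := hC.sum_le (c₀ := 5) (c₁ := 0) (c₂ := -1) (m := -20) fun i => by
    have hmod := hC.congr_of_mod_eq_seven hN (by norm_num) i
    have hz := hC.zero_nonneg hN h i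
    have ht := hC.two_nonneg hN h i
    have hg₁ := hC.square_nonneg hN h hS (-40) (-2) 6 (fun t => t ^ 2 - 7)
      (fun t => t ^ 3 - t ^ 2 - 7 * t + 5) (fun t => by push_cast; ring) i
    have hg₂ := hC.square_nonneg hN h hS (-120) 64 47 (fun t => t ^ 2 + 2 * t)
      (fun t => t ^ 3 + 3 * t ^ 2 + 7 * t + 15) (fun t => by push_cast; ring) i
    have hg₃ := hC.square_nonneg hN h hS 72 (-128) 55 (fun t => t ^ 2)
      (fun t => t ^ 3 - t ^ 2 + 7 * t - 9) (fun t => by push_cast; ring) i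
    obtain ⟨r, hr⟩ := hmod.1
    by_contra
    have hr0 : 0 ≤ r := by omega
    omega
  norm_num at hle

theorem CubicCase.false_of_neg_three_neg_six_eight
    (hC : CubicCase N ev (-3) (-6) 8 135 279 1719) (hN : IsEvenLineMatrix N A β)
    (h : IsSpectralFrame N ev U) (hS : IsLineSpectrum ev) : False := by
  have hle := hC.sum_le (c₀ := 6) (c₁ := 3) (c₂ := -1) (m := -8) fun i => by
    have hmod := hC.congr_of_mod_eq_seven hN (by norm_num) i
    have hz := hC.zero_nonneg hN h i
    have ht := hC.two_nonneg hN h i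
    have hg₁ := hC.square_nonneg hN h hS (-56) (-16) 8 (fun t => t ^ 2 - 2 * t - 7)
      (fun t => t ^ 3 - 3 * t ^ 2 - 5 * t + 7) (fun t => by push_cast; ring) i
    have hg₂ := hC.square_nonneg hN h hS (-72) (-18) 9 (fun t => t ^ 2 - 2 * t - 8)
      (fun t => t ^ 3 - 3 * t ^ 2 - 7 * t + 9) (fun t => by push_cast; ring) i
    have hg₃ := hC.square_nonneg hN h hS 40 (-56) 12 (fun t => t - 3)
      (fun t => t - 5) (fun t => by push_cast; ring) i
    omega
  norm_num at hle

theorem CubicCase.false_of_neg_five_zero_four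
    (hC : CubicCase N ev (-5) 0 4 183 823 4087) (hN : IsEvenLineMatrix N A β)
    (h : IsSpectralFrame N ev U) (hS : IsLineSpectrum ev) : False := by
  have hle := hC.sum_le (c₀ := -3) (c₁ := 1) (c₂ := 0) (m := 10) fun i => by
    have hmod := hC.congr_of_mod_eq_seven hN (by norm_num) i
    have hz := hC.zero_nonneg hN h i
    have ht := hC.two_nonneg hN h i
    have hg₁ := hC.square_nonneg hN h hS 28 (-54) 10 (fun t => t - 5)
      (fun t => t - 7) (fun t => by push_cast; ring) i
    have hg₂ := hC.square_nonneg hN h hS (-28) (-28) 7 (fun t => t ^ 2 - 4 * t - 4)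
      (fun t => t ^ 3 - 5 * t ^ 2 - t + 7) (fun t => by push_cast; ring) i
    omega
  norm_num at hle

theorem CubicCase.false_of_neg_five_zero_eight
    (hC : CubicCase N ev (-5) 0 8 171 671 3299) (hN : IsEvenLineMatrix N A β)
    (h : IsSpectralFrame N ev U) (hS : IsLineSpectrum ev) : False := by
  have hle := hC.sum_le (c₀ := 8) (c₁ := 11) (c₂ := -3) (m := -60) fun i => by
    have hmod := hC.congr_of_mod_eq_three hN (by norm_num) i
    have hz := hC.zero_nonneg hN h i
    have ht := hC.two_nonneg hN h i
    have hg₁ := hC.square_nonneg hN h hS (-8) (-26) 6 (fun t => t ^ 2 - 4 * t - 3)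
      (fun t => t ^ 3 - 5 * t ^ 2 + t + 1) (fun t => by push_cast; ring) i
    have hg₂ := hC.square_nonneg hN h hS (-632) (-400) 135 (fun t => 4 * t ^ 2 - 15 * t - 22)
      (fun t => 16 * t ^ 3 - 72 * t ^ 2 - 71 * t + 79) (fun t => by push_cast; ring) i
    have hg₃ := hC.square_nonneg hN h hS (-536) (-120) 311 (fun t => t ^ 2)
      (fun t => t ^ 3 + 3 * t ^ 2 + 15 * t + 67) (fun t => by push_cast; ring) i
    have hg₄ := hC.square_nonneg hN h hS (-512) (-338) 97 (fun t => 4 * t ^ 2 - 14 * t - 21)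
      (fun t => 16 * t ^ 3 - 64 * t ^ 2 - 68 * t + 64) (fun t => by push_cast; ring) i
    have hg₅ := hC.square_nonneg hN h hS 128 (-120) 20 (fun t => t ^ 2 - 5 * t + 2)
      (fun t => t ^ 3 - 7 * t ^ 2 + 14 * t - 16) (fun t => by push_cast; ring) i
    obtain ⟨r, hr⟩ := hmod.1
    obtain ⟨k, hk⟩ := hmod.2.2
    by_contra
    have hr0 : -1 ≤ r := by omega
    have hr1 : r ≤ 0 := by omega
    have hk0 : 3 ≤ k := by omega
    have hk1 : k ≤ 5 := by omega
    interval_cases r <;> interval_cases k <;> omega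
  norm_num at hle

theorem CubicCase.false_of_neg_five_zero_sixteen
    (hC : CubicCase N ev (-5) 0 16 147 367 1723) (hN : IsEvenLineMatrix N A β)
    (h : IsSpectralFrame N ev U) (hS : IsLineSpectrum ev) : False := by
  have hle := hC.sum_le (c₀ := -12) (c₁ := -1) (c₂ := 1) (m := -24) fun i => by
    have hmod := hC.congr_of_mod_eq_three hN (by norm_num) i
    have hz := hC.zero_nonneg hN h i
    have ht := hC.two_nonneg hN h i
    have hg₁ := hC.square_nonneg hN h hS 64 0 (-4) (fun t => t ^ 2 - 3 * t - 4)
      (fun t => t ^ 3 - 3 * t ^ 2 - 2 * t - 4) (fun t => by push_cast; ring) i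
    have hg₂ := hC.square_nonneg hN h hS 272 104 (-41) (fun t => 2 * t ^ 2 - 5 * t - 14)
      (fun t => 4 * t ^ 3 - 8 * t ^ 2 - 31 * t - 17) (fun t => by push_cast; ring) i
    have hg₃ := hC.square_nonneg hN h hS 80 (-48) 7 (fun t => t - 4)
      (fun t => t - 5) (fun t => by push_cast; ring) i
    have hg₄ := hC.square_nonneg hN h hS 208 80 (-33) (fun t => 2 * t ^ 2 - 5 * t - 12)
      (fun t => 4 * t ^ 3 - 8 * t ^ 2 - 23 * t - 13) (fun t => by push_cast; ring) i
    obtain ⟨r, hr⟩ := hmod.1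
    obtain ⟨k, hk⟩ := hmod.2.2
    by_contra
    have hr0 : -1 ≤ r := by omega
    have hr1 : r ≤ 0 := by omega
    have hk0 : 5 ≤ k := by omega
    have hk1 : k ≤ 8 := by omega
    interval_cases r <;> interval_cases k <;> omega
  norm_num at hle

theorem CubicCase.false_of_neg_seven_ten_eight
    (hC : CubicCase N ev (-7) 10 8 171 607 2355) (hN : IsEvenLineMatrix N A β)
    (h : IsSpectralFrame N ev U) (hS : IsLineSpectrum ev) : False := by
  have hle := hC.sum_le (c₀ := -4) (c₁ := 5) (c₂ := -1) (m := -4) fun i => by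
    have hmod := hC.congr_of_mod_eq_three hN (by norm_num) i
    have hz := hC.zero_nonneg hN h i
    have ht := hC.two_nonneg hN h i
    have hg₁ := hC.square_nonneg hN h hS 56 (-10) 1 (fun t => t - 6)
      (fun t => t - 7) (fun t => by push_cast; ring) i
    have hg₂ := hC.square_nonneg hN h hS 360 (-328) 64 (fun t => 5 * t - 17)
      (fun t => 25 * t - 45) (fun t => by push_cast; ring) i
    have hg₃ := hC.square_nonneg hN h hS (-936) (-1370) 529 (fun t => t ^ 2)
      (fun t => t ^ 3 + 5 * t ^ 2 + 25 * t + 117) (fun t => by push_cast; ring) i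
    omega
  norm_num at hle

theorem CubicCase.false_of_neg_nine_twentyfour_neg_sixteen
    (hC : CubicCase N ev (-9) 24 (-16) 183 759 3063) (hN : IsEvenLineMatrix N A β)
    (h : IsSpectralFrame N ev U) (hS : IsLineSpectrum ev) : False := by
  have hle := hC.sum_le (c₀ := -1) (c₁ := 1) (c₂ := 0) (m := 16) fun i => by
    have hmod := hC.congr_of_mod_eq_seven hN (by norm_num) i
    have hz := hC.zero_nonneg hN h i
    have ht := hC.two_nonneg hN h i
    have hg₁ := hC.square_nonneg hN h hS (-16) 8 (-1) (fun t => t - 4)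
      (fun t => t - 1) (fun t => by push_cast; ring) i
    have hr₁ := hC.diag_nonneg_of_root hN h hS (c₀ := 4) (c₁ := -5) (c₂ := 1)
      (fun t _ ht => by
        push_cast at ht ⊢
        have h0 : (t - 1) * (t - 4) = 0 := by
          have : ((t - 1) * (t - 4)) ^ 2 = 0 := by linear_combination (t - 1) * ht
          exact pow_eq_zero_iff two_ne_zero |>.1 this
        refine le_of_eq ?_
        linear_combination -t * (t - 2) * (t + 8) * h0) i
    have hr₂ := hC.diag_nonneg_of_root hN h hS (c₀ := -4) (c₁ := 5) (c₂ := -1)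
      (fun t _ ht => by
        push_cast at ht ⊢
        have h0 : (t - 1) * (t - 4) = 0 := by
          have : ((t - 1) * (t - 4)) ^ 2 = 0 := by linear_combination (t - 1) * ht
          exact pow_eq_zero_iff two_ne_zero |>.1 this
        refine le_of_eq ?_
        linear_combination t * (t - 2) * (t + 8) * h0) i
    omega
  norm_num at hle

theorem CubicCase.false_of_neg_three_neg_two_four
    (hC : CubicCase N ev (-3) (-2) 4 135 215 1015) (hN : IsEvenLineMatrix N A β)
    (h : IsSpectralFrame N ev U) (hS : IsLineSpectrum ev) : False := by
  have hle := hC.sum_le (c₀ := -1) (c₁ := 1) (c₂ := 0) (m := 0) fun i => by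
    have hmod := hC.congr_of_mod_eq_seven hN (by norm_num) i
    have hz := hC.zero_nonneg hN h i
    have ht := hC.two_nonneg hN h i
    have hg₁ := hC.square_nonneg hN h hS (-12) (-8) 4 (fun t => t ^ 2 - 2 * t - 3)
      (fun t => t ^ 3 - 3 * t ^ 2 - t + 3) (fun t => by push_cast; ring) i
    have hg₂ := hC.square_nonneg hN h hS (-92) (-88) 36 (fun t => 2 * t ^ 2 - 3 * t - 11)
      (fun t => 4 * t ^ 3 - 8 * t ^ 2 - 27 * t + 23) (fun t => by push_cast; ring) i
    omega
  norm_num at hle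

theorem CubicCase.false_of_mem {a b d t₀ t₁ t₂ : ℤ} (hC : CubicCase N ev a b d t₀ t₁ t₂)
    (hN : IsEvenLineMatrix N A β) (h : IsSpectralFrame N ev U) (hS : IsLineSpectrum ev)
    (hmem : (a, b, d, t₀, t₁, t₂) ∈ cubicData) : False := by
  simp only [cubicData, List.mem_cons, Prod.mk.injEq, List.not_mem_nil, or_false] at hmem
  rcases hmem with
    ⟨rfl, rfl, rfl, rfl, rfl, rfl⟩ | ⟨rfl, rfl, rfl, rfl, rfl, rfl⟩ |
    ⟨rfl, rfl, rfl, rfl, rfl, rfl⟩ | ⟨rfl, rfl, rfl, rfl, rfl, rfl⟩ |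
    ⟨rfl, rfl, rfl, rfl, rfl, rfl⟩ | ⟨rfl, rfl, rfl, rfl, rfl, rfl⟩ |
    ⟨rfl, rfl, rfl, rfl, rfl, rfl⟩ | ⟨rfl, rfl, rfl, rfl, rfl, rfl⟩ |
    ⟨rfl, rfl, rfl, rfl, rfl, rfl⟩ | ⟨rfl, rfl, rfl, rfl, rfl, rfl⟩ |
    ⟨rfl, rfl, rfl, rfl, rfl, rfl⟩ | ⟨rfl, rfl, rfl, rfl, rfl, rfl⟩
  · exact hC.false_of_three_zero_neg_four hN h hS
  · exact hC.false_of_one_neg_six_neg_eight hN h hS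
  · exact hC.false_of_neg_one_neg_eight_neg_four hN h hS
  · exact hC.false_of_neg_one_neg_eight_four hN h hS
  · exact hC.false_of_neg_one_neg_eight_eight hN h hS
  · exact hC.false_of_neg_three_neg_six_eight hN h hS
  · exact hC.false_of_neg_five_zero_four hN h hS
  · exact hC.false_of_neg_five_zero_eight hN h hS
  · exact hC.false_of_neg_five_zero_sixteen hN h hS
  · exact hC.false_of_neg_seven_ten_eight hN h hS
  · exact hC.false_of_neg_nine_twentyfour_neg_sixteen hN h hS
  · exact hC.false_of_neg_three_neg_two_four hN h hS

end CubicCases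

section PositiveCases

open Polynomial

variable {N A : Matrix (Fin 21) (Fin 21) ℤ} {β : Fin 21 → ℤ} {ev : Fin 21 → ℝ}
  {U : Fin 21 → Fin 21 → ℝ}

theorem IsSpectralFrame.sum_pair_sq (h : IsSpectralFrame N ev U) (r a : ℤ[X]) (α : ℤ)
    (j u : Fin 21) :
    ∑ k, aeval (ev k) r * (α * U j k - aeval (ev k) a * U u k) ^ 2 =
      ((α ^ 2 * aeval N r j j - 2 * α * aeval N (r * a) j u
        + aeval N (r * a * a) u u : ℤ) : ℝ) := by
  push_cast
  rw [h.entry, h.entry, h.entry, Finset.mul_sum, Finset.mul_sum, ← Finset.sum_sub_distrib,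
    ← Finset.sum_add_distrib]
  refine Finset.sum_congr rfl fun k _ => ?_
  simp only [map_mul]
  ring

theorem IsSpectralFrame.pair_nonneg (h : IsSpectralFrame N ev U) {r : ℤ[X]}
    (hr : ∀ k, 0 ≤ aeval (ev k) r) (a : ℤ[X]) (α : ℤ) (j u : Fin 21) :
    0 ≤ α ^ 2 * aeval N r j j - 2 * α * aeval N (r * a) j u + aeval N (r * a * a) u u := by
  rw [← Int.cast_nonneg_iff (R := ℝ), ← h.sum_pair_sq]
  exact Finset.sum_nonneg fun k _ => mul_nonneg (hr k) (sq_nonneg _)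

theorem IsSpectralFrame.mul_eq_of_pair_eq_zero (h : IsSpectralFrame N ev U) {r : ℤ[X]}
    (hr : ∀ k, 0 ≤ aeval (ev k) r) {a : ℤ[X]} {α : ℤ} {j u : Fin 21}
    (h0 : α ^ 2 * aeval N r j j - 2 * α * aeval N (r * a) j u + aeval N (r * a * a) u u = 0)
    (l : Fin 21) : α * aeval N r l j = aeval N (r * a) l u := by
  have h1 := h.sum_pair_sq r a α j u
  rw [h0, Int.cast_zero, Finset.sum_eq_zero_iff_of_nonneg
    fun k _ => mul_nonneg (hr k) (sq_nonneg _)] at h1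
  rw [← Int.cast_inj (α := ℝ)]
  push_cast
  rw [h.entry, h.entry, Finset.mul_sum]
  refine Finset.sum_congr rfl fun k hk => ?_
  have h2 : aeval (ev k) r * (α * U j k - aeval (ev k) a * U u k) = 0 := by
    rcases mul_eq_zero.1 (h1 k hk) with h3 | h3
    · rw [h3, zero_mul]
    · rw [pow_eq_zero_iff two_ne_zero |>.1 h3, mul_zero]
  rw [map_mul]
  linear_combination U l k * h2

theorem HasTraces.exists_diag_lt {t₀ t₁ t₂ m : ℤ} (hT : HasTraces N t₀ t₁ t₂)
    (hm : t₀ < 21 * m) : ∃ u, residualMatrix N u u < m := by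
  by_contra! hge
  have := hT.sum_le (c₀ := -1) (c₁ := 0) (c₂ := 0) (m := -m) fun i => by linarith [hge i]
  linarith

theorem residual_diag_nonneg (h : IsSpectralFrame N ev U)
    (hpos : ∀ k, 0 ≤ ev k * (ev k - 2) * (ev k + 8)) (i : Fin 21) : 0 ≤ residualMatrix N i i := by
  have := h.diag_nonneg (p := residualPoly) (fun k => by
    rw [aeval_real_residualPoly]; exact hpos k) i
  rwa [aeval_residualPoly] at this

theorem false_of_eq_neg_three (hT : HasTraces N 75 (-225) 675) (hN : IsEvenLineMatrix N A β)
    (h : IsSpectralFrame N ev U) (hev : ∀ k, ev k = -8 ∨ ev k = 0 ∨ ev k = 2 ∨ ev k = -3) :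
    False := by
  obtain ⟨u, hu⟩ := hT.exists_diag_lt (m := 7) (by norm_num)
  have h0 := residual_diag_nonneg h (fun k => by
    rcases hev k with hk | hk | hk | hk <;> rw [hk] <;> norm_num) u
  have := hT.congr_of_mod_eq_three hN (by norm_num) u
  omega

theorem false_of_eq_five (hT : HasTraces N 195 975 4875) (hN : IsEvenLineMatrix N A β)
    (h : IsSpectralFrame N ev U) (hev : ∀ k, ev k = -8 ∨ ev k = 0 ∨ ev k = 2 ∨ ev k = 5) :
    False := by
  have hpos : ∀ k, 0 ≤ ev k * (ev k - 2) * (ev k + 8) := fun k => by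
    rcases hev k with hk | hk | hk | hk <;> rw [hk] <;> norm_num
  obtain ⟨u, hu⟩ := hT.exists_diag_lt (m := 15) (by norm_num)
  have hu7 : residualMatrix N u u = 7 := by
    have := hT.congr_of_mod_eq_three hN (by norm_num) u
    have := residual_diag_nonneg h hpos u
    omega
  have hsq : residualMatrix N * residualMatrix N = (195 : ℤ) • residualMatrix N := by
    have := h.aeval_eq_zero (p := residualPoly * residualPoly - (195 : ℤ) • residualPoly)
      (fun k => by
        simp only [map_sub, map_mul, map_smul, aeval_real_residualPoly]
        rcases hev k with hk | hk | hk | hk <;> rw [hk] <;> norm_num)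
    simp only [map_sub, map_mul, map_smul, aeval_residualPoly] at this
    exact sub_eq_zero.1 this
  have hle : ∀ j, 0 ≤ 7 * residualMatrix N j j - residualMatrix N j u ^ 2 := fun j => by
    have := h.pair_nonneg (r := residualPoly)
      (fun k => by rw [aeval_real_residualPoly]; exact hpos k)
      (residualMatrix N j u • 1) 7 j u
    simp only [mul_smul_comm, mul_one, map_smul, aeval_residualPoly, Matrix.smul_apply,
      smul_eq_mul, hu7] at this
    nlinarith
  have hsum : ∑ j, (7 * residualMatrix N j j - residualMatrix N j u ^ 2) = 0 := by
    have h1 := congrFun (congrFun hsq u) u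
    rw [Matrix.mul_apply, Matrix.smul_apply, hu7] at h1
    have h2 : ∀ j, residualMatrix N j u ^ 2 = residualMatrix N u j * residualMatrix N j u :=
      fun j => by rw [sq]; congr 1; exact hN.residual_isSymm.apply u j
    have h3 := hT.zero
    rw [Matrix.trace] at h3
    simp only [Matrix.diag_apply] at h3
    simp_rw [Finset.sum_sub_distrib, ← Finset.mul_sum, h2, h1, h3]
    norm_num
  have heq : ∀ j, 7 ∣ residualMatrix N j j := fun j => by
    have h1 := (Finset.sum_eq_zero_iff_of_nonneg fun j _ => hle j).1 hsum j (Finset.mem_univ j)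
    have h2 : (7 : ℤ) ∣ residualMatrix N j u :=
      Int.prime_ofNat_iff.2 (by norm_num) |>.dvd_of_dvd_pow
        (n := 2) ⟨residualMatrix N j j, by linarith⟩
    obtain ⟨x, hx⟩ := h2
    exact ⟨x ^ 2, by rw [hx] at h1; linarith⟩
  have h7 : (7 : ℤ) ∣ 195 := by
    rw [← hT.zero, Matrix.trace]
    exact Finset.dvd_sum fun j _ => heq j
  norm_num at h7

end PositiveCases

section QuadraticCases

open Polynomial

variable {N A V : Matrix (Fin 21) (Fin 21) ℤ} {β : Fin 21 → ℤ} {ev : Fin 21 → ℝ}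
  {U : Fin 21 → Fin 21 → ℝ} {c : ℤ} {u : Fin 21}

/-- The Cauchy–Schwarz bound on the plane spanned by column `u` of the residual matrix `R` and
of `V = (N R - R) / 8`. -/
theorem IsSpectralFrame.le_residual_diag (h : IsSpectralFrame N ev U)
    (hpos : ∀ k, 0 ≤ ev k * (ev k - 2) * (ev k + 8))
    (hV : ∀ i j, (N * residualMatrix N) i j = residualMatrix N i j + 8 * V i j)
    (hc : c ^ 2 = 1) (hR : residualMatrix N u u = 3) (hVu : V u u = c)
    (hNW : (N * (N * residualMatrix N)) u u = 35 + 16 * c) (j : Fin 21) :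
    residualMatrix N j u ^ 2 - 4 * c * residualMatrix N j u * V j u + 6 * V j u ^ 2
        ≤ residualMatrix N j j ∧
      (residualMatrix N j u ^ 2 - 4 * c * residualMatrix N j u * V j u + 6 * V j u ^ 2
        = residualMatrix N j j → ∀ l, residualMatrix N l j =
          (residualMatrix N j u - 2 * c * V j u) * (residualMatrix N l u - 2 * c * V l u)
            + 2 * V j u * V l u) := by
  set t := residualMatrix N j u with ht
  set s := V j u with hs
  have hr : ∀ k, 0 ≤ aeval (ev k) residualPoly := fun k => by
    rw [aeval_real_residualPoly]; exact hpos k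
  have hW : ∀ l m, aeval N (residualPoly * ((8 * (t - 2 * c * s) - (6 * s - 2 * c * t)) • 1
      + (6 * s - 2 * c * t) • X)) l m
      = 8 * ((t - 2 * c * s) * residualMatrix N l m + (6 * s - 2 * c * t) * V l m) := fun l m => by
    rw [mul_comm]
    simp only [add_mul, smul_mul_assoc, one_mul, map_add, map_smul, map_mul, aeval_X,
      aeval_residualPoly, Matrix.add_apply, Matrix.smul_apply, smul_eq_mul, hV]
    ring
  have hWW : aeval N (residualPoly * ((8 * (t - 2 * c * s) - (6 * s - 2 * c * t)) • 1
      + (6 * s - 2 * c * t) • X) * ((8 * (t - 2 * c * s) - (6 * s - 2 * c * t)) • 1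
      + (6 * s - 2 * c * t) • X)) u u
      = 64 * (t ^ 2 - 4 * c * t * s + 6 * s ^ 2) := by
    rw [mul_comm, mul_comm residualPoly]
    simp only [add_mul, smul_mul_assoc, one_mul, map_add, map_smul, map_mul, aeval_X,
      aeval_residualPoly, Matrix.add_apply, Matrix.smul_apply, smul_eq_mul, hNW, mul_add,
      Matrix.mul_smul]
    rw [hV u u, hR, hVu]
    linear_combination 64 * (-2 * t ^ 2 + 8 * c * t * s - 12 * s ^ 2) * hc
  have key := h.pair_nonneg hr ((8 * (t - 2 * c * s) - (6 * s - 2 * c * t)) • 1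
      + (6 * s - 2 * c * t) • X) 8 j u
  rw [hWW, hW, aeval_residualPoly, ← ht, ← hs] at key
  refine ⟨by linarith, fun heq l => ?_⟩
  have := h.mul_eq_of_pair_eq_zero hr (a := (8 * (t - 2 * c * s) - (6 * s - 2 * c * t)) • 1
      + (6 * s - 2 * c * t) • X) (α := 8) (j := j) (u := u) (by
        rw [hWW, hW, aeval_residualPoly, ← ht, ← hs]
        linarith) l
  rw [hW, aeval_residualPoly] at this
  rw [mul_left_cancel₀ (by norm_num) this]
  linear_combination -4 * s * V l u * hc

/-- In the two quadratic cases the residual matrix splits off an explicit rank-two factorization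
as soon as it has a diagonal entry `3`. -/
theorem IsSpectralFrame.exists_rank_two (h : IsSpectralFrame N ev U) (hN : IsEvenLineMatrix N A β)
    (hpos : ∀ k, 0 ≤ ev k * (ev k - 2) * (ev k + 8))
    (hV : ∀ i j, (N * residualMatrix N) i j = residualMatrix N i j + 8 * V i j)
    (hc : c ^ 2 = 1) (hR : residualMatrix N u u = 3) (hVu : V u u = c)
    (htr : (residualMatrix N).trace = 135 + 24 * c)
    (hq : N * (N * residualMatrix N) =
      (2 + c) • (N * residualMatrix N) + (7 - c) • residualMatrix N)
    (hsq : residualMatrix N * residualMatrix N =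
      (55 - c) • residualMatrix N + (8 + 9 * c) • (N * residualMatrix N)) :
    ∃ σ δ : Fin 21 → ℤ, ∑ j, σ j ^ 2 = 45 - 8 * c ∧ ∑ j, δ j ^ 2 = 45 + 16 * c ∧
      ∀ j, (σ j + 2 * c * δ j) % 4 = 3 ∧ residualMatrix N j j = σ j ^ 2 + 2 * δ j ^ 2 ∧
        4 * V j j = -c * σ j ^ 2 + 2 * σ j * δ j + 3 * c * δ j ^ 2 := by
  have hRs : ∀ i j, residualMatrix N i j = residualMatrix N j i := fun i j =>
    hN.residual_isSymm.apply j i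
  have hWs : (N * residualMatrix N).IsSymm := by
    rw [Matrix.IsSymm, Matrix.transpose_mul, hN.isSymm, hN.residual_isSymm,
      IsEvenLineMatrix.residual_commute]
  have hVs : ∀ i j, V i j = V j i := fun i j => by
    have := hWs.apply i j
    rw [hV, hV, hRs j i] at this
    linarith
  have hWu : (N * residualMatrix N) u u = 3 + 8 * c := by rw [hV, hR, hVu]
  have hNW : (N * (N * residualMatrix N)) u u = 35 + 16 * c := by
    rw [hq]
    simp only [Matrix.add_apply, Matrix.smul_apply, smul_eq_mul, hWu, hR]
    linear_combination 8 * hc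
  have hNNW : (N * (N * (N * residualMatrix N))) u u = (2 + c) * (35 + 16 * c)
      + (7 - c) * (3 + 8 * c) := by
    rw [hq, Matrix.mul_add, Matrix.mul_smul, Matrix.mul_smul]
    simp only [Matrix.add_apply, Matrix.smul_apply, smul_eq_mul, hWu, hNW]
  have hRW : residualMatrix N * (N * residualMatrix N) =
      N * (residualMatrix N * residualMatrix N) := by
    rw [← Matrix.mul_assoc, ← IsEvenLineMatrix.residual_commute, Matrix.mul_assoc]
  have hWW : N * residualMatrix N * (N * residualMatrix N) =
      N * (N * (residualMatrix N * residualMatrix N)) := by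
    rw [Matrix.mul_assoc, hRW]
  have htt : ∑ j, residualMatrix N j u ^ 2 = 261 + 88 * c := by
    have := congrFun (congrFun hsq u) u
    rw [Matrix.mul_apply] at this
    simp only [Matrix.add_apply, Matrix.smul_apply, smul_eq_mul, hWu, hR, hRs u, ← sq] at this
    rw [this]
    linear_combination 72 * hc
  have hts : ∑ j, residualMatrix N j u * V j u = 40 + 99 * c := by
    have := congrFun (congrFun hRW u) u
    rw [Matrix.mul_apply, hsq, Matrix.mul_add, Matrix.mul_smul, Matrix.mul_smul] at this
    simp only [Matrix.add_apply, Matrix.smul_apply, smul_eq_mul, hWu, hNW, hRs u, hV _ u, mul_add,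
      Finset.sum_add_distrib, mul_left_comm _ (8 : ℤ), ← Finset.mul_sum, ← sq, htt] at this
    linarith [this, hc]
  have hss : ∑ j, V j u ^ 2 = 45 + 16 * c := by
    have := congrFun (congrFun hWW u) u
    rw [Matrix.mul_apply, hsq, Matrix.mul_add, Matrix.mul_smul, Matrix.mul_smul, Matrix.mul_add,
      Matrix.mul_smul, Matrix.mul_smul] at this
    simp only [hWs.apply _ u, Matrix.add_apply, Matrix.smul_apply, smul_eq_mul, hNNW, hNW] at this
    simp only [← sq, hV _ u, add_sq, mul_pow, mul_left_comm _ (8 : ℤ), mul_assoc,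
      Finset.sum_add_distrib, ← Finset.mul_sum, htt, hts] at this
    have hc3 : c ^ 3 = c := by linear_combination c * hc
    linarith
  have hrk := fun j => h.le_residual_diag hpos hV hc hR hVu hNW j
  have hle := (Finset.sum_eq_sum_iff_of_le (s := Finset.univ) fun j _ => (hrk j).1).1 (by
    have h1 : ∑ j, residualMatrix N j j = 135 + 24 * c := htr
    rw [h1]
    simp only [Finset.sum_add_distrib, Finset.sum_sub_distrib, mul_assoc, ← Finset.mul_sum, htt,
      hts, hss]
    linear_combination -396 * hc)
  have hf : ∀ j l, residualMatrix N l j = _ := fun j l => (hrk j).2 (hle j (Finset.mem_univ j)) l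
  have hNR : ∀ j, ∑ l, N j l * residualMatrix N l u = residualMatrix N j u + 8 * V j u :=
    fun j => by rw [← hV, Matrix.mul_apply]
  have hNV : ∀ j, ∑ l, N j l * V l u = residualMatrix N j u + (1 + c) * V j u := fun j => by
    have := congrFun (congrFun hq j) u
    rw [Matrix.mul_apply] at this
    simp only [hV _ u, mul_add, Finset.sum_add_distrib, mul_left_comm _ (8 : ℤ), ← Finset.mul_sum,
      hNR, Matrix.add_apply, Matrix.smul_apply, smul_eq_mul] at this
    linarith
  refine ⟨fun j => residualMatrix N j u - 2 * c * V j u, fun j => V j u, ?_, hss, fun j =>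
    ⟨?_, ?_, ?_⟩⟩
  · have : ∀ j, (residualMatrix N j u - 2 * c * V j u) ^ 2 = residualMatrix N j u ^ 2
        - 4 * c * (residualMatrix N j u * V j u) + 4 * c ^ 2 * V j u ^ 2 := fun j => by ring
    simp only [this, Finset.sum_add_distrib, Finset.sum_sub_distrib, ← Finset.mul_sum, htt, hts,
      hss, hc]
    linear_combination -396 * hc
  · rw [sub_add_cancel]
    exact hN.residual_mod_four j u
  · rw [hf j j]
    ring
  · have h1 := hV j j
    have h2 : ∀ l, N j l * residualMatrix N l j =
        (residualMatrix N j u - 2 * c * V j u) * (N j l * residualMatrix N l u)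
        + (2 * V j u - 2 * c * (residualMatrix N j u - 2 * c * V j u)) * (N j l * V l u) :=
      fun l => by
        rw [hf j l]
        ring
    rw [Matrix.mul_apply, Finset.sum_congr rfl fun l _ => h2 l, Finset.sum_add_distrib,
      ← Finset.mul_sum, ← Finset.mul_sum, hNR, hNV, hf j j] at h1
    refine mul_left_cancel₀ (two_ne_zero (α := ℤ)) ?_
    linear_combination -h1 - 6 * (residualMatrix N j u - 2 * c * V j u) * V j u * hc

theorem eq_one_of_congr {σ δ v : ℤ} (hσ : σ ^ 2 ≤ 37) (hδ : δ ^ 2 ≤ 61) (h4 : (σ + 2 * δ) % 4 = 3)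
    (h8 : 8 ∣ σ ^ 2 + 2 * δ ^ 2 - 3) (hv : 4 * v = -σ ^ 2 + 2 * σ * δ + 3 * δ ^ 2)
    (hodd : v % 2 = 1) (hle : v ≤ 5) (hle' : σ ^ 2 + 2 * δ ^ 2 ≤ 15 + 4 * v) : σ = 1 := by
  have key : ∀ σ ∈ Finset.Icc (-6 : ℤ) 6, ∀ δ ∈ Finset.Icc (-7 : ℤ) 7, (σ + 2 * δ) % 4 = 3 →
      (σ ^ 2 + 2 * δ ^ 2 - 3) % 8 = 0 → (-σ ^ 2 + 2 * σ * δ + 3 * δ ^ 2) % 8 = 4 →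
      -σ ^ 2 + 2 * σ * δ + 3 * δ ^ 2 ≤ 20 →
      σ ^ 2 + 2 * δ ^ 2 ≤ 15 + (-σ ^ 2 + 2 * σ * δ + 3 * δ ^ 2) → σ = 1 := by
    decide +kernel
  exact key σ (Finset.mem_Icc.2 ⟨by nlinarith, by nlinarith⟩) δ
    (Finset.mem_Icc.2 ⟨by nlinarith, by nlinarith⟩) h4 (by omega) (by omega) (by omega) (by omega)

theorem sq_le_sq_of_congr {σ δ v : ℤ} (hσ : σ ^ 2 ≤ 53) (hδ : δ ^ 2 ≤ 29)
    (h4 : (σ - 2 * δ) % 4 = 3) (h8 : 8 ∣ σ ^ 2 + 2 * δ ^ 2 - 3)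
    (hv : 4 * v = σ ^ 2 + 2 * σ * δ - 3 * δ ^ 2) (hodd : v % 2 = 1)
    (hle : σ ^ 2 + 2 * δ ^ 2 + 4 * v ≤ 15) : σ ^ 2 ≤ δ ^ 2 := by
  have key : ∀ σ ∈ Finset.Icc (-7 : ℤ) 7, ∀ δ ∈ Finset.Icc (-5 : ℤ) 5, (σ - 2 * δ) % 4 = 3 →
      (σ ^ 2 + 2 * δ ^ 2 - 3) % 8 = 0 → (σ ^ 2 + 2 * σ * δ - 3 * δ ^ 2) % 8 = 4 →
      σ ^ 2 + 2 * δ ^ 2 + (σ ^ 2 + 2 * σ * δ - 3 * δ ^ 2) ≤ 15 → σ ^ 2 ≤ δ ^ 2 := by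
    decide +kernel
  exact key σ (Finset.mem_Icc.2 ⟨by nlinarith, by nlinarith⟩) δ
    (Finset.mem_Icc.2 ⟨by nlinarith, by nlinarith⟩) h4 (by omega) (by omega) (by omega)

theorem IsSpectralFrame.quadratic_relation (h : IsSpectralFrame N ev U)
    (hev : ∀ k, ev k = -8 ∨ ev k = 0 ∨ ev k = 2 ∨ ev k ^ 2 = (2 + c) * ev k + (7 - c)) :
    N * (N * residualMatrix N) =
      (2 + c) • (N * residualMatrix N) + (7 - c) • residualMatrix N := by
  have := h.aeval_eq_zero (p := X * (X * residualPoly) - ((2 + c) • (X * residualPoly)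
    + (7 - c) • residualPoly)) (fun k => by
      simp only [map_sub, map_add, map_mul, map_smul, aeval_X, aeval_real_residualPoly]
      simp only [zsmul_eq_mul]
      push_cast
      rcases hev k with hk | hk | hk | hk
      · rw [hk]; ring
      · rw [hk]; ring
      · rw [hk]; ring
      · linear_combination ev k * (ev k - 2) * (ev k + 8) * hk)
  simp only [map_sub, map_add, map_mul, map_smul, aeval_X, aeval_residualPoly] at this
  exact sub_eq_zero.1 this

theorem IsSpectralFrame.residual_sq (h : IsSpectralFrame N ev U) (hc : c ^ 2 = 1)
    (hev : ∀ k, ev k = -8 ∨ ev k = 0 ∨ ev k = 2 ∨ ev k ^ 2 = (2 + c) * ev k + (7 - c)) :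
    residualMatrix N * residualMatrix N =
      (55 - c) • residualMatrix N + (8 + 9 * c) • (N * residualMatrix N) := by
  have := h.aeval_eq_zero (p := residualPoly * residualPoly - ((55 - c) • residualPoly
    + (8 + 9 * c) • (X * residualPoly))) (fun k => by
      have hc' : (c : ℝ) ^ 2 = 1 := by exact_mod_cast hc
      simp only [map_sub, map_add, map_mul, map_smul, aeval_X, aeval_real_residualPoly]
      simp only [zsmul_eq_mul]
      push_cast
      rcases hev k with hk | hk | hk | hk
      · rw [hk]; ring
      · rw [hk]; ring
      · rw [hk]; ring
      · linear_combination ev k * (ev k - 2) * (ev k + 8) * ((ev k + 8 + c) * hk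
          + (ev k - 1) * hc'))
  simp only [map_sub, map_add, map_mul, map_smul, aeval_X, aeval_residualPoly] at this
  exact sub_eq_zero.1 this

theorem HasTraces.trace_quotient {t₀ t₁ t₂ : ℤ} (hT : HasTraces N t₀ t₁ t₂)
    (hV : ∀ i j, (N * residualMatrix N) i j = residualMatrix N i j + 8 * V i j) :
    8 * V.trace = t₁ - t₀ := by
  have e : N * residualMatrix N = residualMatrix N + (8 : ℤ) • V := by
    ext i j
    rw [hV, Matrix.add_apply, Matrix.smul_apply, smul_eq_mul]
  have := hT.one
  rw [e, Matrix.trace_add, Matrix.trace_smul, hT.zero, smul_eq_mul] at this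
  linarith

theorem IsSpectralFrame.sq_le_residual_diag (h : IsSpectralFrame N ev U)
    (hpos : ∀ k, 0 ≤ ev k * (ev k - 2) * (ev k + 8)) (hR : residualMatrix N u u = 3) :
    (N * residualMatrix N) u u ^ 2 ≤ 3 * (N * (N * residualMatrix N)) u u := by
  have := h.pair_nonneg (r := residualPoly)
    (fun k => by rw [aeval_real_residualPoly]; exact hpos k)
    ((3 : ℤ) • X) ((N * residualMatrix N) u u) u u
  simp only [smul_mul_assoc, mul_smul_comm, map_smul, map_mul, aeval_X, aeval_residualPoly,
    Matrix.smul_apply, smul_eq_mul, hR] at this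
  simp only [← IsEvenLineMatrix.residual_commute, Matrix.mul_assoc] at this
  nlinarith

theorem false_of_sq_eq_three_mul (hT : HasTraces N 159 519 2511) (hN : IsEvenLineMatrix N A β)
    (h : IsSpectralFrame N ev U)
    (hev : ∀ k, ev k = -8 ∨ ev k = 0 ∨ ev k = 2 ∨ ev k ^ 2 = 3 * ev k + 6) : False := by
  have hpos : ∀ k, 0 ≤ ev k * (ev k - 2) * (ev k + 8) := fun k => by
    rcases hev k with hk | hk | hk | hk
    · rw [hk]; norm_num
    · rw [hk]; norm_num
    · rw [hk]; norm_num
    · have : -2 ≤ ev k := by nlinarith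
      have e : ev k * (ev k - 2) * (ev k + 8) = 17 * ev k + 54 := by
        linear_combination (ev k + 9) * hk
      linarith
  have hev' : ∀ k, ev k = -8 ∨ ev k = 0 ∨ ev k = 2 ∨
      ev k ^ 2 = (2 + (1 : ℤ)) * ev k + (7 - (1 : ℤ)) := fun k => by
    have := hev k
    norm_num at this ⊢
    exact this
  have hq := h.quadratic_relation hev'
  obtain ⟨V, hV, h3, hV2, -⟩ := hN.congr_of_trace_mod_eq_seven (by rw [hT.zero]; rfl)
  have hVtr := hT.trace_quotient hV
  have hle : ∀ i, V i i ≤ 5 := fun i => by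
    have := h.diag_form_nonneg hN (c₀ := 1) (c₁ := -1) (c₂ := 0) (d₀ := 0) (d₁ := 64) (d₂ := 8)
      (fun k => by
        push_cast
        rcases hev k with hk | hk | hk | hk
        · rw [hk]; norm_num
        · rw [hk]; norm_num
        · rw [hk]; norm_num
        · refine le_of_eq ?_
          linear_combination ev k * (ev k + 8) * hk) i
    have := hV i i
    linarith
  have hle' : ∀ i, residualMatrix N i i ≤ 15 + 4 * V i i := fun i => by
    have := h.diag_form_nonneg hN (c₀ := -3) (c₁ := 1) (c₂ := 0) (d₀ := 96) (d₁ := -36) (d₂ := -6)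
      (fun k => by
        push_cast
        rcases hev k with hk | hk | hk | hk
        · rw [hk]; norm_num
        · rw [hk]; norm_num
        · rw [hk]; norm_num
        · refine le_of_eq ?_
          linear_combination -(ev k - 2) * (ev k + 8) * hk) i
    have := hV i i
    linarith
  obtain ⟨u, hu⟩ := hT.exists_diag_lt (m := 11) (by norm_num)
  have hR : residualMatrix N u u = 3 := by
    have := residual_diag_nonneg h hpos u
    have := h3 u
    omega
  have hVu : V u u = 1 := by
    have h1 := h.sq_le_residual_diag hpos hR
    rw [hq] at h1
    simp only [Matrix.add_apply, Matrix.smul_apply, smul_eq_mul, hV u u, hR] at h1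
    have h2 := hV2 u
    have : -1 < V u u := by nlinarith
    have : V u u < 3 := by nlinarith
    omega
  obtain ⟨σ, δ, hσ, hδ, hd⟩ := h.exists_rank_two hN hpos hV (by norm_num) hR hVu
    (by rw [hT.zero]; norm_num) hq (h.residual_sq (by norm_num) hev')
  have h1 : ∀ j, σ j = 1 := fun j => by
    obtain ⟨h4, hρ, hv⟩ := hd j
    have hσj := Finset.single_le_sum (fun i _ => sq_nonneg (σ i)) (Finset.mem_univ j)
    have hδj := Finset.single_le_sum (fun i _ => sq_nonneg (δ i)) (Finset.mem_univ j)
    have h3j := h3 j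
    have h2j := hV2 j
    have hle'j := hle' j
    rw [hρ] at h3j hle'j
    exact eq_one_of_congr (by linarith) (by linarith) (by omega) h3j (by linarith) (by omega)
      (hle j) hle'j
  simp [h1] at hσ

theorem false_of_sq_eq_add_eight (hT : HasTraces N 111 39 927) (hN : IsEvenLineMatrix N A β)
    (h : IsSpectralFrame N ev U)
    (hev : ∀ k, ev k = -8 ∨ ev k = 0 ∨ ev k = 2 ∨ ev k ^ 2 = ev k + 8) : False := by
  have hpos : ∀ k, 0 ≤ ev k * (ev k - 2) * (ev k + 8) := fun k => by
    rcases hev k with hk | hk | hk | hk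
    · rw [hk]; norm_num
    · rw [hk]; norm_num
    · rw [hk]; norm_num
    · have : ev k ≤ 5 := by nlinarith
      have e : ev k * (ev k - 2) * (ev k + 8) = -ev k + 56 := by
        linear_combination (ev k + 7) * hk
      linarith
  have hev' : ∀ k, ev k = -8 ∨ ev k = 0 ∨ ev k = 2 ∨
      ev k ^ 2 = (2 + (-1 : ℤ)) * ev k + (7 - (-1 : ℤ)) := fun k => by
    have := hev k
    norm_num at this ⊢
    exact this
  have hq := h.quadratic_relation hev'
  obtain ⟨V, hV, h3, hV2, -⟩ := hN.congr_of_trace_mod_eq_seven (by rw [hT.zero]; rfl)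
  have hVtr := hT.trace_quotient hV
  have hle : ∀ i, residualMatrix N i i + 4 * V i i ≤ 15 := fun i => by
    have := h.diag_form_nonneg hN (c₀ := -1) (c₁ := -1) (c₂ := 0) (d₀ := 0) (d₁ := 48) (d₂ := 6)
      (fun k => by
        push_cast
        rcases hev k with hk | hk | hk | hk
        · rw [hk]; norm_num
        · rw [hk]; norm_num
        · rw [hk]; norm_num
        · refine le_of_eq ?_
          linear_combination ev k * (ev k + 8) * hk) i
    have := hV i i
    linarith
  obtain ⟨u, hu⟩ := hT.exists_diag_lt (m := 11) (by norm_num)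
  have hR : residualMatrix N u u = 3 := by
    have := residual_diag_nonneg h hpos u
    have := h3 u
    omega
  have hVu : V u u = -1 := by
    have h1 := h.sq_le_residual_diag hpos hR
    rw [hq] at h1
    simp only [Matrix.add_apply, Matrix.smul_apply, smul_eq_mul, hV u u, hR] at h1
    have h2 := hV2 u
    have : -3 < V u u := by nlinarith
    have : V u u < 1 := by nlinarith
    omega
  obtain ⟨σ, δ, hσ, hδ, hd⟩ := h.exists_rank_two hN hpos hV (by norm_num) hR hVu
    (by rw [hT.zero]; norm_num) hq (h.residual_sq (by norm_num) hev')
  have h1 : ∀ j, σ j ^ 2 ≤ δ j ^ 2 := fun j => by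
    obtain ⟨h4, hρ, hv⟩ := hd j
    have hσj := Finset.single_le_sum (fun i _ => sq_nonneg (σ i)) (Finset.mem_univ j)
    have hδj := Finset.single_le_sum (fun i _ => sq_nonneg (δ i)) (Finset.mem_univ j)
    have h3j := h3 j
    have h2j := hV2 j
    have hlej := hle j
    rw [hρ] at h3j hlej
    exact sq_le_sq_of_congr (v := V j j) (by linarith) (by linarith) (by omega) h3j (by linarith)
      (by omega) hlej
  have h2 := Finset.sum_le_sum fun j (_ : j ∈ Finset.univ) => h1 j
  rw [hσ, hδ] at h2
  norm_num at h2

end QuadraticCases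

/-- The maximum number of equiangular lines in `ℝ¹²` with common angle `1/5`
is exactly `20`: there are `20` unit vectors in `ℝ¹²` whose pairwise inner products all have
absolute value `1/5`, but there are no `21` such unit vectors. -/
theorem stmt_14 :
    (∃ x : Fin 20 → EuclideanSpace ℝ (Fin 12),
      (∀ i, ‖x i‖ = 1) ∧ ∀ i j, i ≠ j → |⟪x i, x j⟫| = 1 / 5) ∧
    ¬ (∃ x : Fin 21 → EuclideanSpace ℝ (Fin 12),
      (∀ i, ‖x i‖ = 1) ∧ ∀ i j, i ≠ j → |⟪x i, x j⟫| = 1 / 5) := by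
  refine ⟨exists_twenty_equiangular, fun ⟨x, hx, hxx⟩ => ?_⟩
  obtain ⟨N, A, b, ev, U, hN, h, hS⟩ := exists_spectral_data hx hxx
  rcases spectrum_cases hN h hS with ⟨hT, hev⟩ | ⟨hT, hev⟩ | ⟨hT, hev⟩ | ⟨hT, hev⟩ |
    ⟨_, _, _, _, _, _, hmem, hC⟩
  · exact false_of_eq_five hT hN h hev
  · exact false_of_eq_neg_three hT hN h hev
  · exact false_of_sq_eq_add_eight hT hN h hev
  · exact false_of_sq_eq_three_mul hT hN h hev
  · exact hC.false_of_mem hN h hS hmem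
end

section
/- Let S₆ be a Seidel matrix of order 6 with spectrum {−√5 with multiplicity 3, √5 with multiplicity 3}, and let S′ := J₃ ⊗ (S₆ − I₆) + I₁₈. Then S′ is a Seidel matrix of order 18 with exactly three distinct eigenvalues (namely 1 with multiplicity 12, −2+3√5 with multiplicity 3, and −2−3√5 with multiplicity 3), and no Seidel matrix equivalent to S′ has a regular ambient graph; that is, the switching class of S′ contains no regular graph. -/
open Polynomial Matrix

/-- A Seidel matrix: a real symmetric matrix with zero diagonal and all off-diagonal
entries equal to `±1`. -/
def IsSeidel {m : Type*} (S : Matrix m m ℝ) : Prop :=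
  S.IsSymm ∧ (∀ i, S i i = 0) ∧ ∀ i j, i ≠ j → S i j = 1 ∨ S i j = -1

/-- A signed permutation matrix: exactly one nonzero entry, equal to `±1`, in each row and
in each column. -/
def IsSignedPerm {m : Type*} [Fintype m] [DecidableEq m] (P : Matrix m m ℝ) : Prop :=
  ∃ (σ : Equiv.Perm m) (ε : m → ℝ), (∀ i, ε i = 1 ∨ ε i = -1) ∧
    ∀ i j, P i j = if i = σ j then ε j else 0

/-- Equivalence of Seidel matrices: `S₂ = P S₁ Pᵀ` for some signed permutation matrix `P`. -/
def SeidelEquiv {m : Type*} [Fintype m] [DecidableEq m] (S₁ S₂ : Matrix m m ℝ) : Prop :=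
  ∃ P : Matrix m m ℝ, IsSignedPerm P ∧ S₂ = P * S₁ * Pᵀ

/-- The ambient graph `Γ(T)` of a Seidel matrix `T`, whose adjacency matrix is
`(J − I − T)/2`; i.e. distinct vertices `i, j` are adjacent iff `T i j = −1`. -/
def ambientGraph {m : Type*} (T : Matrix m m ℝ) : SimpleGraph m :=
  SimpleGraph.fromRel fun i j => T i j = -1

/-- A graph is regular if all vertices have the same degree. -/
def IsRegularGraph {V : Type*} (G : SimpleGraph V) : Prop :=
  ∃ d : ℕ, ∀ v, (G.neighborSet v).ncard = d

/-- The matrix `J₃ ⊗ (S − I) + I`. -/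
abbrev tripleBlowup {m : Type*} [DecidableEq m] (S : Matrix m m ℝ) :
    Matrix (Fin 3 × m) (Fin 3 × m) ℝ :=
  Matrix.kroneckerMap (· * ·) (Matrix.of fun (_ _ : Fin 3) => (1 : ℝ)) (S - 1) + 1

lemma IsSeidel.tripleBlowup {m : Type*} [DecidableEq m] {S : Matrix m m ℝ} (hS : IsSeidel S) :
    IsSeidel (tripleBlowup S) := by
  obtain ⟨hsymm, hdiag, hoff⟩ := hS
  refine ⟨?_, ?_, ?_⟩
  · ext ⟨a, i⟩ ⟨b, j⟩
    simp [Matrix.one_apply, hsymm.apply i j, eq_comm]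
  · rintro ⟨a, i⟩
    simp [hdiag]
  · rintro ⟨a, i⟩ ⟨b, j⟩ hne
    by_cases hij : i = j
    · subst hij
      right
      simp [hdiag, Matrix.one_apply_ne hne]
    · simpa [Matrix.one_apply_ne hne, Matrix.one_apply_ne hij] using hoff i j hij

lemma det_scalar_sub_allOnes_kronecker {m : Type*} [Fintype m] [DecidableEq m]
    (M : Matrix m m ℝ) (y : ℝ) :
    (Matrix.scalar (Fin 3 × m) y - Matrix.kroneckerMap (· * ·)
      (Matrix.of fun (_ _ : Fin 3) => (1 : ℝ)) M).det =
      y ^ (2 * Fintype.card m) * (Matrix.scalar m y - (3 : ℝ) • M).det := by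
  let U : Matrix (Fin 3 × m) m ℝ := Matrix.of fun p j => if p.2 = j then 1 else 0
  have hU : Matrix.kroneckerMap (· * ·) (Matrix.of fun (_ _ : Fin 3) => (1 : ℝ)) M =
      U * (M * Uᵀ) := by
    ext ⟨a, i⟩ ⟨b, j⟩
    simp [U, Matrix.mul_apply]
  have hU' : M * Uᵀ * U = (3 : ℝ) • M := by
    rw [Matrix.mul_assoc]
    have : Uᵀ * U = (3 : ℝ) • (1 : Matrix m m ℝ) := by
      ext i j
      simp [U, Matrix.mul_apply, Fintype.sum_prod_type, Matrix.one_apply]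
      split_ifs <;> simp_all
    rw [this]
    simp
  have h := congrArg (Polynomial.eval y) (Matrix.charpoly_mul_comm_of_le U (M * Uᵀ) (by
    rw [Fintype.card_prod, Fintype.card_fin]; omega))
  rw [← hU, hU', Fintype.card_prod, Fintype.card_fin] at h
  rw [← Matrix.eval_charpoly, ← Matrix.eval_charpoly, h, eval_mul, eval_pow, eval_X]
  congr 2
  omega

lemma eval_charpoly_tripleBlowup {m : Type*} [Fintype m] [DecidableEq m]
    (S : Matrix m m ℝ) (x : ℝ) :
    (tripleBlowup S).charpoly.eval x =
      (x - 1) ^ (2 * Fintype.card m) * (3 ^ Fintype.card m * S.charpoly.eval ((x + 2) / 3)) := by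
  rw [Matrix.eval_charpoly, Matrix.eval_charpoly, ← Matrix.det_smul,
    show (3 : ℝ) • (Matrix.scalar m ((x + 2) / 3) - S) =
      Matrix.scalar m (x - 1) - (3 : ℝ) • (S - 1) from ?_,
    ← det_scalar_sub_allOnes_kronecker]
  · congr 1
    rw [tripleBlowup, map_sub, map_one]
    abel
  · ext i j
    by_cases hij : i = j
    · subst hij; simp; ring
    · simp [hij]

/-- A regular ambient graph forces constant row sums of the form `n - 1 - 2d`. -/
lemma IsSeidel.sum_row_of_isRegularGraph {m : Type*} [Fintype m] {T : Matrix m m ℝ}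
    (hT : IsSeidel T) {d : ℕ} (hd : ∀ v, ((ambientGraph T).neighborSet v).ncard = d) (i : m) :
    ∑ j, T i j = Fintype.card m - 1 - 2 * d := by
  classical
  obtain ⟨hsymm, hdiag, hoff⟩ := hT
  have hentry : ∀ j, T i j =
      1 - (if i = j then 1 else 0) - 2 * (if (ambientGraph T).Adj i j then 1 else 0) := by
    intro j
    by_cases hij : i = j
    · subst hij; simp [hdiag]
    · have hadj : (ambientGraph T).Adj i j ↔ T i j = -1 := by
        simp [ambientGraph, hij, hsymm.apply i j]
      rcases hoff i j hij with h | h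
      · norm_num [hadj, h, hij]
      · norm_num [hadj, h, hij]
  have hcard : (∑ j, if (ambientGraph T).Adj i j then (1 : ℝ) else 0) = d := by
    rw [← hd i, Finset.sum_boole, Set.ncard_eq_toFinset_card']
    congr 2
    ext j
    simp
  rw [Finset.sum_congr rfl fun j _ => hentry j, Finset.sum_sub_distrib, Finset.sum_sub_distrib,
    ← Finset.mul_sum, hcard]
  simp

lemma conj_signedPerm_apply {m : Type*} [Fintype m] [DecidableEq m] {P : Matrix m m ℝ}
    {σ : Equiv.Perm m} {ε : m → ℝ} (hP : ∀ i j, P i j = if i = σ j then ε j else 0)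
    (S : Matrix m m ℝ) (i j : m) : (P * S * Pᵀ) (σ i) (σ j) = ε i * S i j * ε j := by
  simp [Matrix.mul_apply, hP]

lemma IsSeidel.conj_signedPerm {m : Type*} [Fintype m] [DecidableEq m] {S T : Matrix m m ℝ}
    (hS : IsSeidel S) (h : SeidelEquiv S T) : IsSeidel T := by
  obtain ⟨P, ⟨σ, ε, hε, hP⟩, rfl⟩ := h
  obtain ⟨hsymm, hdiag, hoff⟩ := hS
  have happly := conj_signedPerm_apply hP S
  refine ⟨?_, fun i => ?_, fun i j hij => ?_⟩
  · rw [Matrix.IsSymm, Matrix.transpose_mul, Matrix.transpose_mul, Matrix.transpose_transpose,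
      hsymm.eq, Matrix.mul_assoc]
  · obtain ⟨i, rfl⟩ := σ.surjective i
    rw [happly, hdiag]
    simp
  · obtain ⟨i, rfl⟩ := σ.surjective i
    obtain ⟨j, rfl⟩ := σ.surjective j
    rw [happly]
    rcases hε i with h₁ | h₁ <;> rcases hε j with h₂ | h₂ <;>
      rcases hoff i j (fun h => hij (congrArg σ h)) with h₃ | h₃ <;> simp [h₁, h₂, h₃]

/-- If the ambient graph of a Seidel matrix equivalent to `S` is regular of degree `d`, then
`S` has a `±1`-eigenvector with eigenvalue `n - 1 - 2d`. -/
lemma SeidelEquiv.exists_sign_eigenvector {m : Type*} [Fintype m] [DecidableEq m]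
    {S T : Matrix m m ℝ} (hS : IsSeidel S) (h : SeidelEquiv S T)
    {d : ℕ} (hd : ∀ v, ((ambientGraph T).neighborSet v).ncard = d) :
    ∃ ε : m → ℝ, (∀ i, ε i = 1 ∨ ε i = -1) ∧
      ∀ i, ∑ j, S i j * ε j = (Fintype.card m - 1 - 2 * d) * ε i := by
  have hrow := (hS.conj_signedPerm h).sum_row_of_isRegularGraph hd
  obtain ⟨P, ⟨σ, ε, hε, hP⟩, rfl⟩ := h
  refine ⟨ε, hε, fun i => ?_⟩
  have hi := hrow (σ i)
  rw [← Equiv.sum_comp σ] at hi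
  simp only [conj_signedPerm_apply hP, mul_assoc, ← Finset.mul_sum] at hi
  rw [← hi]
  rcases hε i with h | h <;> simp [h]

/-- A sum over the three blocks of a sign eigenvector of the blow-up is a nonzero eigenvector
of the original matrix. -/
lemma eval_charpoly_eq_zero_of_sign_eigenvector {m : Type*} [Fintype m] [DecidableEq m]
    [Nonempty m] {S : Matrix m m ℝ} {ε : Fin 3 × m → ℝ} (hε : ∀ p, ε p = 1 ∨ ε p = -1) {k : ℝ}
    (hk : ∀ p, ∑ q, tripleBlowup S p q * ε q = k * ε p) :
    S.charpoly.eval ((k + 2) / 3) = 0 := by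
  let w : m → ℝ := fun i => ∑ a, ε (a, i)
  have hblock : ∀ a i, ∑ j, S i j * w j - w i + ε (a, i) = k * ε (a, i) := by
    intro a i
    rw [← hk (a, i)]
    simp only [tripleBlowup, Matrix.add_apply, add_mul, Finset.sum_add_distrib]
    congr 1
    · simp only [Matrix.kroneckerMap_apply, Matrix.of_apply, one_mul, Matrix.sub_apply]
      rw [Fintype.sum_prod_type, Finset.sum_comm]
      simp [w, sub_mul, ← Finset.mul_sum, Matrix.one_apply]
    · simp [Matrix.one_apply]
  rw [Matrix.eval_charpoly, ← Matrix.exists_mulVec_eq_zero_iff]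
  refine ⟨w, fun hw => ?_, ?_⟩
  · obtain ⟨i⟩ := ‹Nonempty m›
    have h := congrFun hw i
    simp only [w, Fin.sum_univ_three, Pi.zero_apply] at h
    rcases hε (0, i) with h₀ | h₀ <;> rcases hε (1, i) with h₁ | h₁ <;>
      rcases hε (2, i) with h₂ | h₂ <;> norm_num [h₀, h₁, h₂] at h
  · ext i
    have hw : w i = ε (0, i) + ε (1, i) + ε (2, i) := Fin.sum_univ_three _
    have hmul : (S *ᵥ w) i = ∑ j, S i j * w j := rfl
    rw [Matrix.sub_mulVec, Pi.sub_apply, hmul]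
    simp only [Matrix.scalar_apply, Matrix.mulVec_diagonal, Pi.zero_apply]
    linear_combination (-hblock 0 i - hblock 1 i - hblock 2 i + (k - 1) * hw) / 3

lemma int_sq_ne_forty_five (t : ℤ) : t ^ 2 ≠ 45 := by
  intro h
  have hlow : -7 < t := by nlinarith
  have hupp : t < 7 := by nlinarith
  interval_cases t <;> norm_num at h

/-- Let `S₆` be a Seidel matrix of order `6` with spectrum
`{−√5 with multiplicity 3, √5 with multiplicity 3}`, and set
`S' := J₃ ⊗ (S₆ − I₆) + I₁₈`.  Then `S'` is a Seidel matrix of order `18` with exactly three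
distinct eigenvalues (`1` with multiplicity `12`, `−2+3√5` and `−2−3√5` each with
multiplicity `3`), and no Seidel matrix equivalent to `S'` has a regular ambient graph, i.e.
the switching class of `S'` contains no regular graph. -/
theorem stmt_16 (S₆ : Matrix (Fin 6) (Fin 6) ℝ) (hS₆ : IsSeidel S₆)
    (hspec : S₆.charpoly = (X - C (-Real.sqrt 5)) ^ 3 * (X - C (Real.sqrt 5)) ^ 3) :
    IsSeidel (Matrix.kroneckerMap (· * ·)
        (Matrix.of fun (_ _ : Fin 3) => (1 : ℝ)) (S₆ - 1) + 1) ∧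
    (Matrix.kroneckerMap (· * ·)
        (Matrix.of fun (_ _ : Fin 3) => (1 : ℝ)) (S₆ - 1) + 1).charpoly =
      (X - C 1) ^ 12 * (X - C (-2 + 3 * Real.sqrt 5)) ^ 3 *
        (X - C (-2 - 3 * Real.sqrt 5)) ^ 3 ∧
    (Matrix.kroneckerMap (· * ·)
        (Matrix.of fun (_ _ : Fin 3) => (1 : ℝ)) (S₆ - 1) + 1).charpoly.roots.toFinset.card
      = 3 ∧
    ∀ T : Matrix (Fin 3 × Fin 6) (Fin 3 × Fin 6) ℝ,
      SeidelEquiv (Matrix.kroneckerMap (· * ·)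
        (Matrix.of fun (_ _ : Fin 3) => (1 : ℝ)) (S₆ - 1) + 1) T →
      ¬ IsRegularGraph (ambientGraph T) := by
  have hsq : Real.sqrt 5 ^ 2 = 5 := Real.sq_sqrt (by norm_num)
  have hlt : 1 < Real.sqrt 5 := Real.lt_sqrt_of_sq_lt (by norm_num)
  have hchar : (tripleBlowup S₆).charpoly = (X - C 1) ^ 12 *
      (X - C (-2 + 3 * Real.sqrt 5)) ^ 3 * (X - C (-2 - 3 * Real.sqrt 5)) ^ 3 := by
    refine Polynomial.funext fun x => ?_
    rw [eval_charpoly_tripleBlowup, hspec]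
    simp only [eval_mul, eval_pow, eval_sub, eval_X, eval_C, Fintype.card_fin]
    ring
  have hseidel := hS₆.tripleBlowup
  refine ⟨hseidel, hchar, ?_, ?_⟩
  · have hne : ∀ c : ℝ, ∀ n, (X - C c) ^ n ≠ 0 := fun c n => pow_ne_zero n (X_sub_C_ne_zero c)
    have h₁ : (1 : ℝ) ≠ -2 + 3 * Real.sqrt 5 := fun h => by linarith only [h, hlt]
    have h₂ : (1 : ℝ) ≠ -2 - 3 * Real.sqrt 5 := fun h => by linarith only [h, hlt]
    have h₃ : -2 + 3 * Real.sqrt 5 ≠ -2 - 3 * Real.sqrt 5 := fun h => by linarith only [h, hlt]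
    have hroots : (tripleBlowup S₆).charpoly.roots.toFinset =
        {1, -2 + 3 * Real.sqrt 5, -2 - 3 * Real.sqrt 5} := by
      ext x
      rw [Multiset.mem_toFinset, hchar,
        mem_roots (mul_ne_zero (mul_ne_zero (hne _ _) (hne _ _)) (hne _ _))]
      simp only [IsRoot, eval_mul, eval_pow, eval_sub, eval_X, eval_C, mul_eq_zero,
        pow_eq_zero_iff, ne_eq, OfNat.ofNat_ne_zero, not_false_eq_true, sub_eq_zero,
        Finset.mem_insert, Finset.mem_singleton, or_assoc]
    rw [hroots, Finset.card_eq_three]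
    exact ⟨_, _, _, h₁, h₂, h₃, rfl⟩
  · rintro T hT ⟨d, hd⟩
    obtain ⟨ε, hε, hk⟩ := hT.exists_sign_eigenvector hseidel hd
    have h := eval_charpoly_eq_zero_of_sign_eigenvector hε hk
    rw [hspec, ← mul_pow, eval_pow, pow_eq_zero_iff three_ne_zero] at h
    simp only [eval_mul, eval_sub, eval_X, eval_C, Fintype.card_prod, Fintype.card_fin] at h
    push_cast at h
    have hreal : (19 - 2 * (d : ℝ)) ^ 2 = 45 := by linear_combination 9 * h + 9 * hsq
    have hint : (19 - 2 * (d : ℤ)) ^ 2 = 45 := by exact_mod_cast hreal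
    exact int_sq_ne_forty_five _ hint
end
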